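/- Every triangulation αT of an n-simplex T is equivalent by finitely many elementary moves to the trivial triangulation {T}. -/

import Mathlib

open Set MeasureTheory
open scoped Classical
noncomputable section

/-- Ambient Euclidean space `ℝ^N`. -/
abbrev Euc (N : ℕ) := EuclideanSpace ℝ (Fin N)

/-- `s` is an `n`-simplex: the convex hull of `n+1` affinely independent points. -/
def IsSimplex {N : ℕ} (n : ℕ) (s : Set (Euc N)) : Prop :=
  ∃ v : Fin (n + 1) → Euc N, AffineIndependent ℝ v ∧ s = convexHull ℝ (Set.range v)

/-- The (affine) dimension of a set: the rank of its vector span. -/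
def sdim {N : ℕ} (s : Set (Euc N)) : ℕ := Module.finrank ℝ (vectorSpan ℝ s)

/-- A polytope: the compact convex hull of finitely many points (nonempty). -/
def IsPolytope {N : ℕ} (s : Set (Euc N)) : Prop :=
  ∃ t : Finset (Euc N), t.Nonempty ∧ s = convexHull ℝ (t : Set (Euc N))

/-- An `n`-polyhedron: a finite union of `n`-dimensional polytopes. -/
def IsPolyhedron {N : ℕ} (n : ℕ) (P : Set (Euc N)) : Prop :=
  ∃ F : Finset (Set (Euc N)), F.Nonempty ∧ (∀ Q ∈ F, IsPolytope Q ∧ sdim Q = n) ∧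
    (⋃ Q ∈ F, Q) = P

/-- A triangulation of the `n`-dimensional set `P`: a finite set of `n`-simplices with
union `P`, any two distinct ones intersecting in a set of dimension less than `n`. -/
def IsTriangulation {N : ℕ} (n : ℕ) (P : Set (Euc N)) (F : Finset (Set (Euc N))) : Prop :=
  (∀ T ∈ F, IsSimplex n T) ∧ (⋃ T ∈ F, T) = P ∧
    ∀ S ∈ F, ∀ T ∈ F, S ≠ T → sdim (S ∩ T) < n

/-- A starring of `P` at `a`: a triangulation all of whose simplices have a vertex at `a`. -/
def IsStarring {N : ℕ} (n : ℕ) (P : Set (Euc N)) (a : Euc N) (F : Finset (Set (Euc N))) : Prop :=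
  IsTriangulation n P F ∧
    ∀ T ∈ F, ∃ v : Fin (n + 1) → Euc N, AffineIndependent ℝ v ∧
      T = convexHull ℝ (Set.range v) ∧ a ∈ Set.range v

/-- `T` is dissected into the two `n`-simplices `T₁, T₂` by a hyperplane containing an
`(n-2)`-dimensional face of `T`. -/
def IsDissection {N : ℕ} (n : ℕ) (T T₁ T₂ : Set (Euc N)) : Prop :=
  IsSimplex n T₁ ∧ IsSimplex n T₂ ∧ T₁ ∪ T₂ = T ∧ T₁ ≠ T₂ ∧
  ∃ (f : Euc N →ₗ[ℝ] ℝ) (c : ℝ), f ≠ 0 ∧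
    T₁ = T ∩ {x | f x ≤ c} ∧ T₂ = T ∩ {x | c ≤ f x} ∧
    ∃ v : Fin (n + 1) → Euc N, AffineIndependent ℝ v ∧ T = convexHull ℝ (Set.range v) ∧
      ∃ s : Finset (Fin (n + 1)), s.card = n - 1 ∧ ∀ i ∈ s, f (v i) = c

/-- An elementary move: dissect one simplex of the triangulation into two `n`-simplices by a
hyperplane containing an `(n-2)`-face, or merge two simplices whose union is again a simplex. -/
def ElemMove {N : ℕ} (n : ℕ) (F G : Finset (Set (Euc N))) : Prop :=
  (∃ T ∈ F, ∃ T₁ T₂, IsDissection n T T₁ T₂ ∧ G = insert T₁ (insert T₂ (F.erase T))) ∨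
  (∃ T₁ ∈ F, ∃ T₂ ∈ F, T₁ ≠ T₂ ∧ IsSimplex n (T₁ ∪ T₂) ∧
    G = insert (T₁ ∪ T₂) ((F.erase T₁).erase T₂))

/-- Equivalence by finitely many elementary moves. -/
def MoveEquiv {N : ℕ} (n : ℕ) (F G : Finset (Set (Euc N))) : Prop :=
  Relation.ReflTransGen (ElemMove n) F G

/-- `μ` is a valuation on the class `S` of sets. -/
def IsValuation {N : ℕ} (S : Set (Set (Euc N))) (μ : Set (Euc N) → ℝ) : Prop :=
  μ ∅ = 0 ∧ ∀ A ∈ S, ∀ B ∈ S, A ∪ B ∈ S → A ∩ B ∈ S →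
    μ A + μ B = μ (A ∪ B) + μ (A ∩ B)

/-- `𝒯ⁿ`: simplices of dimension at most `n` (together with `∅`). -/
def simplexClass (N n : ℕ) : Set (Set (Euc N)) :=
  {s | s = ∅ ∨ ∃ k ≤ n, IsSimplex k s}

/-- `𝒫ⁿ`: polytopes of dimension at most `n` (together with `∅`). -/
def polytopeClass (N n : ℕ) : Set (Set (Euc N)) :=
  {s | s = ∅ ∨ (IsPolytope s ∧ sdim s ≤ n)}

/-- `𝒬ⁿ`: polyhedra (finite unions of polytopes) of dimension at most `n` (with `∅`). -/
def polyhedronClass (N n : ℕ) : Set (Set (Euc N)) :=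
  {s | s = ∅ ∨ ((∃ F : Finset (Set (Euc N)), F.Nonempty ∧ (∀ Q ∈ F, IsPolytope Q) ∧
      (⋃ Q ∈ F, Q) = s) ∧ sdim s ≤ n)}



/-! Part A: simplicial functionals and prisms. -/

/-- Simplicial functional on multisets of `k` points of `K`. -/
structure IsFun0 {V : Type} [AddCommGroup V] [Module ℝ V] {M : Type} [AddCommMonoid M]
    (k : ℕ) (K : Set V) (φ : Multiset V → M) : Prop where
  conv : Convex ℝ K
  rep : ∀ a s, a ∈ K → (∀ x ∈ s, x ∈ K) → s.card + 2 = k → φ (a ::ₘ a ::ₘ s) = 0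
  cut : ∀ a b m s, a ∈ K → b ∈ K → (∀ x ∈ s, x ∈ K) → s.card + 2 = k → m ∈ segment ℝ a b →
    φ (a ::ₘ b ::ₘ s) = φ (a ::ₘ m ::ₘ s) + φ (m ::ₘ b ::ₘ s)

section functional
variable {V : Type} [AddCommGroup V] [Module ℝ V] {M : Type} [AddCommMonoid M]

lemma IsFun0.cone {k : ℕ} {K : Set V} {φ : Multiset V → M} (h : IsFun0 (k+1) K φ) {a : V}
    (ha : a ∈ K) : IsFun0 k K (fun s => φ (a ::ₘ s)) where
  conv := h.conv
  rep := by
    intro b s hb hs hc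
    have := h.rep b (a ::ₘ s) hb (by simpa [ha] using hs) (by simp; omega)
    rw [← this]; congr 1
    rw [Multiset.cons_swap a b, Multiset.cons_swap a b]
  cut := by
    intro b c m s hb hc' hs hc hm
    have := h.cut b c m (a ::ₘ s) hb hc' (by simpa [ha] using hs) (by simp; omega) hm
    simp only [Multiset.cons_swap a] at this ⊢
    exact this

/-- Exchange of the diagonals of a quadrilateral. -/
lemma IsFun0.flip {k : ℕ} {K : Set V} {φ : Multiset V → M} (h : IsFun0 k K φ) {p q r s z : V}
    {t : Multiset V} (hp : p ∈ K) (hq : q ∈ K) (hr : r ∈ K) (hs : s ∈ K) (ht : ∀ x ∈ t, x ∈ K)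
    (hc : t.card + 3 = k) (hz : z ∈ segment ℝ p q) (hz' : z ∈ segment ℝ r s) :
    φ (p ::ₘ q ::ₘ r ::ₘ t) + φ (p ::ₘ q ::ₘ s ::ₘ t) =
      φ (r ::ₘ s ::ₘ p ::ₘ t) + φ (r ::ₘ s ::ₘ q ::ₘ t) := by
  have e1 := h.cut p q z (r ::ₘ t) hp hq (by simpa [hr] using ht) (by simp; omega) hz
  have e2 := h.cut p q z (s ::ₘ t) hp hq (by simpa [hs] using ht) (by simp; omega) hz
  have e3 := h.cut r s z (p ::ₘ t) hr hs (by simpa [hp] using ht) (by simp; omega) hz'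
  have e4 := h.cut r s z (q ::ₘ t) hr hs (by simpa [hq] using ht) (by simp; omega) hz'
  rw [e1, e2, e3, e4]
  have s1 : ∀ a b c : V, a ::ₘ b ::ₘ c ::ₘ t = c ::ₘ b ::ₘ a ::ₘ t := by
    intro a b c
    rw [Multiset.cons_swap a b, Multiset.cons_swap a c, Multiset.cons_swap b c]
  have s2 : z ::ₘ q ::ₘ s ::ₘ t = z ::ₘ s ::ₘ q ::ₘ t := by rw [Multiset.cons_swap q s]
  rw [s1 p z r, s1 p z s, s2]
  have s3 : z ::ₘ q ::ₘ r ::ₘ t = r ::ₘ z ::ₘ q ::ₘ t := by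
    rw [Multiset.cons_swap q r, Multiset.cons_swap z r]
  have s4 : s ::ₘ z ::ₘ p ::ₘ t = z ::ₘ s ::ₘ p ::ₘ t := Multiset.cons_swap _ _ _
  rw [s3, s4]
  abel

end functional

section prism
variable {W : Type} [AddCommGroup W] [Module ℝ W] {M : Type} [AddCommMonoid M]

/-- Standard decomposition of the prism between the graphs of `g` and `g'`. -/
def Pr (g g' : W →ᵃ[ℝ] ℝ) : (Multiset (W × ℝ) → M) → List W → M
  | _, [] => 0
  | φ, x :: l => φ ((x, g x) ::ₘ (x, g' x) ::ₘ ((l.map fun y => (y, g' y) : List (W × ℝ)) : Multiset (W × ℝ)))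
      + Pr g g' (fun s => φ ((x, g x) ::ₘ s)) l

/-- Base set over which prisms stay inside `K`. -/
def PrK (g g' : W →ᵃ[ℝ] ℝ) (K : Set (W × ℝ)) : Set W :=
  {y | (y, g y) ∈ K ∧ (y, g' y) ∈ K ∧ g y ≤ g' y}

lemma Pr_congr (g g' : W →ᵃ[ℝ] ℝ) (l : List W) :
    ∀ {φ φ' : Multiset (W × ℝ) → M},
    (∀ s, s.card = l.length + 1 → (∀ x ∈ s, ∃ y ∈ l, x = (y, g y) ∨ x = (y, g' y)) → φ s = φ' s) →
    Pr g g' φ l = Pr g g' φ' l := by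
  induction l with
  | nil => intros; rfl
  | cons x l ih =>
    intro φ φ' h
    simp only [Pr]
    congr 1
    · apply h
      · simp
      · intro z hz
        simp at hz
        rcases hz with rfl | rfl | ⟨y, hy, rfl⟩
        · exact ⟨x, by simp, Or.inl rfl⟩
        · exact ⟨x, by simp, Or.inr rfl⟩
        · exact ⟨y, by simp [hy], Or.inr rfl⟩
    · apply ih
      intro s hs hx
      apply h
      · simp [hs]
      · intro z hz
        simp only [Multiset.mem_cons] at hz
        rcases hz with rfl | hz
        · exact ⟨x, by simp, Or.inl rfl⟩
        · obtain ⟨y, hy, h⟩ := hx z hz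
          exact ⟨y, by simp [hy], h⟩

lemma Pr_zero_fun (g g' : W →ᵃ[ℝ] ℝ) (l : List W) :
    Pr g g' (fun _ => (0:M)) l = 0 := by
  induction l with
  | nil => rfl
  | cons x l ih => simp [Pr, ih]

lemma Pr_zero (g g' : W →ᵃ[ℝ] ℝ) (l : List W) {φ : Multiset (W × ℝ) → M}
    (h : ∀ s, s.card = l.length + 1 → (∀ x ∈ s, ∃ y ∈ l, x = (y, g y) ∨ x = (y, g' y)) → φ s = 0) :
    Pr g g' φ l = 0 := by
  rw [← Pr_zero_fun (M := M) g g' l]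
  exact Pr_congr g g' l h

lemma Pr_add (g g' : W →ᵃ[ℝ] ℝ) (l : List W) : ∀ (φ φ' : Multiset (W × ℝ) → M),
    Pr g g' (fun s => φ s + φ' s) l = Pr g g' φ l + Pr g g' φ' l := by
  induction l with
  | nil => intros; simp [Pr]
  | cons x l ih => intro φ φ'; simp only [Pr, ih]; abel

lemma mem_graph_of {g g' : W →ᵃ[ℝ] ℝ} {K : Set (W × ℝ)} {l : List W}
    (hl : ∀ y ∈ l, y ∈ PrK g g' K) {s : Multiset (W × ℝ)}
    (hs : ∀ x ∈ s, ∃ y ∈ l, x = (y, g y) ∨ x = (y, g' y)) : ∀ x ∈ s, x ∈ K := by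
  intro x hx
  obtain ⟨y, hy, rfl | rfl⟩ := hs x hx
  · exact (hl y hy).1
  · exact (hl y hy).2.1

/-- crossing of the diagonals over two vertical segments -/
lemma cross_vert (x y : W) {a b c d : ℝ} (h1 : a ≤ b) (h2 : c ≤ d) :
    (a = b ∧ c = d) ∨ ∃ z : W × ℝ, z ∈ segment ℝ (x, a) (y, d) ∧ z ∈ segment ℝ (x, b) (y, c) := by
  rcases eq_or_lt_of_le (add_nonneg (sub_nonneg.2 h1) (sub_nonneg.2 h2)) with h | h
  · left; constructor <;> linarith
  · right
    set p := b - a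
    set q := d - c
    have hp : 0 ≤ p := sub_nonneg.2 h1
    have hq : 0 ≤ q := sub_nonneg.2 h2
    refine ⟨(q/(p+q)) • (x, a) + (p/(p+q)) • (y, d),
      ⟨q/(p+q), p/(p+q), by positivity, by positivity, by field_simp; ring, rfl⟩,
      ⟨q/(p+q), p/(p+q), by positivity, by positivity, by field_simp; ring, ?_⟩⟩
    ext
    · simp
    · simp [p, q]
      have : b - a + (d - c) ≠ 0 := h.ne'
      field_simp
      ring

lemma Pr_perm {g g' : W →ᵃ[ℝ] ℝ} {K : Set (W × ℝ)} {l l' : List W} (hp : l.Perm l') :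
    ∀ {k : ℕ} {φ : Multiset (W × ℝ) → M}, IsFun0 k K φ → l.length + 1 = k →
    (∀ y ∈ l, y ∈ PrK g g' K) → Pr g g' φ l = Pr g g' φ l' := by
  induction hp with
  | nil => intros; rfl
  | @cons x l₁ l₂ hp ih =>
    intro k φ h hk hl
    simp only [Pr]
    congr 1
    · congr 3
      exact Multiset.coe_eq_coe.2 (hp.map _)
    · obtain ⟨k, rfl⟩ : ∃ k', k = k' + 1 := ⟨l₁.length + 1, by simp at hk; omega⟩
      exact ih (h.cone (hl x (by simp)).1) (by simp at hk; omega) (fun y hy => hl y (by simp [hy]))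
  | swap x y l =>
    intro k φ h hk hl
    simp only [Pr, List.map_cons, ← Multiset.cons_coe]
    have hx := hl x (by simp)
    have hy := hl y (by simp)
    have hlK : ∀ z ∈ ((l.map fun y => (y, g' y) : List (W × ℝ)) : Multiset (W × ℝ)), z ∈ K := by
      intro z hz
      simp at hz
      obtain ⟨w, hw, rfl⟩ := hz
      exact (hl w (by simp [hw])).2.1
    set t := ((l.map fun y => (y, g' y) : List (W × ℝ)) : Multiset (W × ℝ)) with ht
    have htc : t.card = l.length := by simp [ht]
    rw [← add_assoc, ← add_assoc]
    congr 1
    · rcases cross_vert y x hy.2.2 hx.2.2 with ⟨e1, e2⟩ | ⟨z, hz, hz'⟩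
      · simp only [List.length_cons] at hk
        rw [← e1, ← e2]
        have a1 := h.rep (y, g y) ((x, g x) ::ₘ t) hy.1 (by simpa [hx.1] using hlK) (by simp; omega)
        have a2 := h.rep (x, g x) ((y, g y) ::ₘ t) hx.1 (by simpa [hy.1] using hlK) (by simp; omega)
        simp only [Multiset.cons_swap _ (y, g y)] at *
        simp only [Multiset.cons_swap _ (x, g x)] at *
        simp [a1, a2]
      · have := h.flip (t := t) hy.1 hx.2.1 hy.2.1 hx.1 hlK (by simp at hk; omega) hz hz'
        have s1 : ∀ a b c : W × ℝ, a ::ₘ b ::ₘ c ::ₘ t = a ::ₘ c ::ₘ b ::ₘ t := by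
          intro a b c
          rw [Multiset.cons_swap b c]
        have s2 : ∀ a b c : W × ℝ, a ::ₘ b ::ₘ c ::ₘ t = b ::ₘ a ::ₘ c ::ₘ t := by
          intro a b c
          rw [Multiset.cons_swap a b]
        rw [s1 (y, g y) (y, g' y) (x, g' x), s1 (y, g y) (x, g x) (x, g' x), this, add_comm]
        congr 2
        · rw [s2, s1]
        · rw [s2, s1]
    · congr 1
      funext s
      rw [Multiset.cons_swap]
  | trans h1 h2 ih1 ih2 =>
    intro k φ h hk hl
    rw [ih1 h hk hl, ih2 h (by rw [← h1.length_eq]; exact hk) (fun y hy => hl y (h1.mem_iff.2 hy))]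

end prism


section prism2
variable {W : Type} [AddCommGroup W] [Module ℝ W] {M : Type} [AddCommMonoid M]

/-- graph lift of a list -/
def gl (g : W →ᵃ[ℝ] ℝ) (l : List W) : Multiset (W × ℝ) :=
  ((l.map fun y => (y, g y) : List (W × ℝ)) : Multiset (W × ℝ))

lemma gl_cons (g : W →ᵃ[ℝ] ℝ) (x : W) (l : List W) : gl g (x :: l) = (x, g x) ::ₘ gl g l := rfl

lemma gl_card (g : W →ᵃ[ℝ] ℝ) (l : List W) : (gl g l).card = l.length := by simp [gl]

lemma mem_gl {g : W →ᵃ[ℝ] ℝ} {l : List W} {z : W × ℝ} : z ∈ gl g l ↔ ∃ y ∈ l, (y, g y) = z := by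
  simp [gl]

lemma Pr_cons (g g' : W →ᵃ[ℝ] ℝ) (φ : Multiset (W × ℝ) → M) (x : W) (l : List W) :
    Pr g g' φ (x :: l) = φ ((x, g x) ::ₘ (x, g' x) ::ₘ gl g' l)
      + Pr g g' (fun s => φ ((x, g x) ::ₘ s)) l := rfl

lemma Pr_sweep {g g' : W →ᵃ[ℝ] ℝ} {K : Set (W × ℝ)} (x : W) {a b : ℝ} (hab : a ≤ b)
    (ha : (x, a) ∈ K) (hb : (x, b) ∈ K) (l : List W) :
    ∀ {k : ℕ} {φ : Multiset (W × ℝ) → M}, IsFun0 k K φ → l.length + 2 = k →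
    (∀ y ∈ l, y ∈ PrK g g' K) →
    φ ((x, a) ::ₘ (x, b) ::ₘ gl g l) + Pr g g' (fun s => φ ((x, b) ::ₘ s)) l =
    φ ((x, a) ::ₘ (x, b) ::ₘ gl g' l) + Pr g g' (fun s => φ ((x, a) ::ₘ s)) l := by
  induction l with
  | nil => intros; simp [gl, Pr]
  | cons y l ih =>
    intro k φ h hk hl
    obtain ⟨k, rfl⟩ : ∃ k', k = k' + 1 := ⟨l.length + 2, by simp at hk; omega⟩
    have hk' : l.length + 2 = k := by simp at hk; omega
    have hy := hl y (by simp)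
    have hl' : ∀ y ∈ l, y ∈ PrK g g' K := fun z hz => hl z (by simp [hz])
    have h1 := ih (h.cone hy.1) hk' hl'
    simp only [Pr_cons, gl_cons]
    have hK : ∀ z ∈ gl g' l, z ∈ K := by
      intro z hz
      obtain ⟨w, hw, rfl⟩ := mem_gl.1 hz
      exact (hl' w hw).2.1
    have key : φ ((y, g y) ::ₘ (x, a) ::ₘ (x, b) ::ₘ gl g' l)
        + φ ((x, b) ::ₘ (y, g y) ::ₘ (y, g' y) ::ₘ gl g' l) =
        φ ((x, a) ::ₘ (x, b) ::ₘ (y, g' y) ::ₘ gl g' l)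
        + φ ((x, a) ::ₘ (y, g y) ::ₘ (y, g' y) ::ₘ gl g' l) := by
      set t := gl g' l with ht
      have htc : t.card = l.length := by simp [ht, gl_card]
      have s1 : ∀ a b c : W × ℝ, a ::ₘ b ::ₘ c ::ₘ t = a ::ₘ c ::ₘ b ::ₘ t := by
        intro a b c
        rw [Multiset.cons_swap b c]
      have s2 : ∀ a b c : W × ℝ, a ::ₘ b ::ₘ c ::ₘ t = b ::ₘ a ::ₘ c ::ₘ t := by
        intro a b c
        rw [Multiset.cons_swap a b]
      rcases cross_vert x y hab hy.2.2 with ⟨e1, e2⟩ | ⟨z, hz, hz'⟩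
      · rw [← e1, ← e2]
        have a1 := h.rep (y, g y) ((x, a) ::ₘ t) hy.1 (by simpa [ha] using hK) (by simp; omega)
        have a2 := h.rep (x, a) ((y, g y) ::ₘ t) ha (by simpa [hy.1] using hK) (by simp; omega)
        rw [s2 (y, g y) (x, a), s1 (x, a) (y, g y) (x, a), a2, s2 (x, a) (y, g y) (y, g y),
          s1 (y, g y) (x, a) (y, g y), a1]
      · have := h.flip (t := t) ha hy.2.1 hb hy.1 hK (by omega) hz hz'
        rw [s2 (y, g y) (x, a), s1 (x,a) (y, g y) (x, b), s2 (x, a) (x, b) (y, g y),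
          s1 (x, b) (x, a) (y, g y), s1 (x, a) (x, b) (y, g' y),
          s1 (x, a) (y, g y) (y, g' y), this]
    have e1 : (x, a) ::ₘ (x, b) ::ₘ (y, g y) ::ₘ gl g l = (y, g y) ::ₘ (x, a) ::ₘ (x, b) ::ₘ gl g l := by
      rw [Multiset.cons_swap (x, b), Multiset.cons_swap (x, a)]
    have e2 : ∀ c : ℝ, Pr g g' (fun s => φ ((x, c) ::ₘ (y, g y) ::ₘ s)) l
        = Pr g g' (fun s => φ ((y, g y) ::ₘ (x, c) ::ₘ s)) l := by
      intro c; congr 1; funext s; rw [Multiset.cons_swap]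
    rw [e1, e2, e2]
    calc _ = φ ((x, b) ::ₘ (y, g y) ::ₘ (y, g' y) ::ₘ gl g' l) +
        (φ ((y, g y) ::ₘ (x, a) ::ₘ (x, b) ::ₘ gl g l) +
          Pr g g' (fun s => φ ((y, g y) ::ₘ (x, b) ::ₘ s)) l) := by abel
      _ = _ := by
        rw [h1, ← add_assoc, add_comm (φ ((x, b) ::ₘ (y, g y) ::ₘ (y, g' y) ::ₘ gl g' l)), key]
        abel

lemma vert_mem_segment (x : W) {a h b : ℝ} (h1 : a ≤ h) (h2 : h ≤ b) :
    (x, h) ∈ segment ℝ (x, a) (x, b) := by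
  rw [← Prod.image_mk_segment_right]
  exact ⟨h, by rw [segment_eq_Icc (h1.trans h2)]; exact ⟨h1, h2⟩, rfl⟩

/-- Stacked prisms. -/
lemma Pr_stack {g g' g'' : W →ᵃ[ℝ] ℝ} {K : Set (W × ℝ)} (l : List W) :
    ∀ {k : ℕ} {φ : Multiset (W × ℝ) → M}, IsFun0 k K φ → l.length + 1 = k →
    (∀ y ∈ l, y ∈ PrK g g' K) → (∀ y ∈ l, y ∈ PrK g' g'' K) →
    Pr g g'' φ l = Pr g g' φ l + Pr g' g'' φ l := by
  induction l with
  | nil => intros; simp [Pr]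
  | cons x l ih =>
    intro k φ h hk h1 h2
    obtain ⟨k, rfl⟩ : ∃ k', k = k' + 1 := ⟨l.length + 1, by simp at hk; omega⟩
    have hk' : l.length + 1 = k := by simp at hk; omega
    have hx1 := h1 x (by simp)
    have hx2 := h2 x (by simp)
    have hl1 : ∀ y ∈ l, y ∈ PrK g g' K := fun z hz => h1 z (by simp [hz])
    have hl2 : ∀ y ∈ l, y ∈ PrK g' g'' K := fun z hz => h2 z (by simp [hz])
    simp only [Pr_cons]
    rw [ih (h.cone hx1.1) hk' hl1 hl2]
    have sw := Pr_sweep x hx1.2.2 hx1.1 hx1.2.1 l h (by omega) hl2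
    have hK : ∀ z ∈ gl g'' l, z ∈ K := by
      intro z hz
      obtain ⟨w, hw, rfl⟩ := mem_gl.1 hz
      exact (hl2 w hw).2.1
    have seg : (x, g' x) ∈ segment ℝ (x, g x) (x, g'' x) :=
      vert_mem_segment x hx1.2.2 hx2.2.2
    have ct := h.cut (x, g x) (x, g'' x) (x, g' x) (gl g'' l) hx1.1 hx2.2.1 hK
      (by rw [gl_card]; omega) seg
    rw [ct]
    calc _ = φ ((x, g' x) ::ₘ (x, g'' x) ::ₘ gl g'' l) + Pr g g' (fun s => φ ((x, g x) ::ₘ s)) l +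
          (φ ((x, g x) ::ₘ (x, g' x) ::ₘ gl g'' l) +
          Pr g' g'' (fun s => φ ((x, g x) ::ₘ s)) l) := by abel
      _ = _ := by rw [← sw]; abel

/-- The prism between equal sheets is zero. -/
lemma Pr_eq_zero {g g' : W →ᵃ[ℝ] ℝ} {K : Set (W × ℝ)} (l : List W) :
    ∀ {k : ℕ} {φ : Multiset (W × ℝ) → M}, IsFun0 k K φ → l.length + 1 = k →
    (∀ y ∈ l, y ∈ PrK g g' K) → (∀ y ∈ l, g y = g' y) → Pr g g' φ l = 0 := by
  induction l with
  | nil => intros; simp [Pr]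
  | cons x l ih =>
    intro k φ h hk h1 h2
    obtain ⟨k, rfl⟩ : ∃ k', k = k' + 1 := ⟨l.length + 1, by simp at hk; omega⟩
    have hk' : l.length + 1 = k := by simp at hk; omega
    have hx1 := h1 x (by simp)
    have hl1 : ∀ y ∈ l, y ∈ PrK g g' K := fun z hz => h1 z (by simp [hz])
    rw [Pr_cons, ih (h.cone hx1.1) hk' hl1 (fun z hz => h2 z (by simp [hz])), ← h2 x (by simp),
      h.rep _ _ hx1.1 _ (by rw [gl_card]; omega), add_zero]
    intro z hz
    obtain ⟨w, hw, rfl⟩ := mem_gl.1 hz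
    exact (hl1 w hw).2.1

/-- prism over a multiset -/
def PrM (g g' : W →ᵃ[ℝ] ℝ) (φ : Multiset (W × ℝ) → M) (D : Multiset W) : M := Pr g g' φ D.toList

lemma PrM_coe {g g' : W →ᵃ[ℝ] ℝ} {K : Set (W × ℝ)} {l : List W} {k : ℕ}
    {φ : Multiset (W × ℝ) → M} (h : IsFun0 k K φ) (hk : l.length + 1 = k)
    (hl : ∀ y ∈ l, y ∈ PrK g g' K) : PrM g g' φ (l : Multiset W) = Pr g g' φ l := by
  have hp : ((l : Multiset W).toList).Perm l := Multiset.coe_eq_coe.1 (Multiset.coe_toList _)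
  exact Pr_perm hp h (by rw [hp.length_eq]; exact hk) (fun y hy => hl y (hp.mem_iff.1 hy))

lemma PrK_convex (g g' : W →ᵃ[ℝ] ℝ) {K : Set (W × ℝ)} (hK : Convex ℝ K) :
    Convex ℝ (PrK g g' K) := by
  intro x hx y hy a b ha hb hab
  have hg : ∀ g : W →ᵃ[ℝ] ℝ, g (a • x + b • y) = a * g x + b * g y := by
    intro g; rw [Convex.combo_affine_apply hab]; simp
  refine ⟨?_, ?_, ?_⟩
  · have := hK hx.1 hy.1 ha hb hab
    rw [hg]; simpa using this
  · have := hK hx.2.1 hy.2.1 ha hb hab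
    rw [hg]; simpa using this
  · rw [hg, hg]
    have := mul_le_mul_of_nonneg_left hx.2.2 ha
    have := mul_le_mul_of_nonneg_left hy.2.2 hb
    linarith

lemma graph_segment (g : W →ᵃ[ℝ] ℝ) {x y m : W} (hm : m ∈ segment ℝ x y) :
    (m, g m) ∈ segment ℝ (x, g x) (y, g y) := by
  obtain ⟨a, b, ha, hb, hab, rfl⟩ := hm
  refine ⟨a, b, ha, hb, hab, ?_⟩
  rw [Convex.combo_affine_apply hab]; simp

lemma PrM_isFun0 {g g' : W →ᵃ[ℝ] ℝ} {K : Set (W × ℝ)} {k : ℕ}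
    {φ : Multiset (W × ℝ) → M} (h : IsFun0 (k + 1) K φ) :
    IsFun0 k (PrK g g' K) (PrM g g' φ) where
  conv := PrK_convex g g' h.conv
  rep := by
    intro x s hx hs hk
    obtain ⟨l, rfl⟩ := Quot.exists_rep s
    change ∀ y ∈ (l : Multiset W), _ at hs
    change (l : Multiset W).card + 2 = k at hk
    change PrM g g' φ ((x :: x :: l : List W) : Multiset W) = 0
    simp only [Multiset.coe_card, Multiset.mem_coe] at hs hk
    rw [PrM_coe h (by simp; omega) (by simpa [hx] using hs), Pr_cons, Pr_cons, gl_cons]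
    have hK : ∀ z ∈ gl g' l, z ∈ K := by
      intro z hz
      obtain ⟨w, hw, rfl⟩ := mem_gl.1 hz
      exact (hs w hw).2.1
    have e : (x, g x) ::ₘ (x, g' x) ::ₘ (x, g' x) ::ₘ gl g' l =
      (x, g' x) ::ₘ (x, g' x) ::ₘ (x, g x) ::ₘ gl g' l := by
      rw [Multiset.cons_swap (x, g x), Multiset.cons_swap (x, g x)]
    rw [e, h.rep _ _ hx.2.1 (by simpa [hx.1] using hK) (by simp [gl_card]; omega),
      h.rep _ _ hx.1 (by simpa [hx.2.1] using hK) (by simp [gl_card]; omega), zero_add, zero_add]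
    apply Pr_zero
    intro s hsc hs'
    apply h.rep _ _ hx.1 (mem_graph_of hs hs') (by omega)
  cut := by
    intro x y m s hx hy hs hk hm
    obtain ⟨l, rfl⟩ := Quot.exists_rep s
    change ∀ y ∈ (l : Multiset W), _ at hs
    change (l : Multiset W).card + 2 = k at hk
    have hmK : m ∈ PrK g g' K := (PrK_convex g g' h.conv).segment_subset hx hy hm
    change PrM g g' φ ((x :: y :: l : List W) : Multiset W) =
      PrM g g' φ ((x :: m :: l : List W) : Multiset W) +
      PrM g g' φ ((m :: y :: l : List W) : Multiset W)
    simp only [Multiset.coe_card, Multiset.mem_coe] at hs hk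
    rw [PrM_coe h (by simp; omega) (by simpa [hx, hy] using hs),
      PrM_coe h (by simp; omega) (by simpa [hx, hmK] using hs),
      PrM_coe h (by simp; omega) (by simpa [hmK, hy] using hs)]
    simp only [Pr_cons, gl_cons]
    have hK : ∀ z ∈ gl g' l, z ∈ K := by
      intro z hz
      obtain ⟨w, hw, rfl⟩ := mem_gl.1 hz
      exact (hs w hw).2.1
    have e0 : Pr g g' (fun s => φ ((x, g x) ::ₘ (y, g y) ::ₘ s)) l =
        Pr g g' (fun s => φ ((x, g x) ::ₘ (m, g m) ::ₘ s)) l +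
        Pr g g' (fun s => φ ((m, g m) ::ₘ (y, g y) ::ₘ s)) l := by
      rw [← Pr_add]
      apply Pr_congr
      intro s hsc hs'
      exact h.cut _ _ _ _ hx.1 hy.1 (mem_graph_of hs hs') (by omega) (graph_segment g hm)
    rw [e0]
    set t := gl g' l with ht
    have htc : t.card = l.length := by simp [ht, gl_card]
    have s1 : ∀ a b c : W × ℝ, a ::ₘ b ::ₘ c ::ₘ t = a ::ₘ c ::ₘ b ::ₘ t := by
      intro a b c
      rw [Multiset.cons_swap b c]
    have s2 : ∀ a b c : W × ℝ, a ::ₘ b ::ₘ c ::ₘ t = b ::ₘ a ::ₘ c ::ₘ t := by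
      intro a b c
      rw [Multiset.cons_swap a b]
    have c1 := h.cut (x, g' x) (y, g' y) (m, g' m) ((x, g x) ::ₘ t) hx.2.1 hy.2.1
      (by simpa [hx.1] using hK) (by simp; omega) (graph_segment g' hm)
    have c2 := h.cut (x, g x) (y, g y) (m, g m) ((y, g' y) ::ₘ t) hx.1 hy.1
      (by simpa [hy.2.1] using hK) (by simp; omega) (graph_segment g hm)
    obtain ⟨z, hz, hz'⟩ : ∃ z, z ∈ segment ℝ (x, g x) (y, g' y) ∧
        z ∈ segment ℝ (m, g m) (m, g' m) := by
      obtain ⟨a, b, ha, hb, hab, rfl⟩ := hm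
      refine ⟨a • (x, g x) + b • (y, g' y), ⟨a, b, ha, hb, hab, rfl⟩, ?_⟩
      have hg : ∀ g : W →ᵃ[ℝ] ℝ, g (a • x + b • y) = a * g x + b * g y := by
        intro g; rw [Convex.combo_affine_apply hab]; simp
      have h1 := mul_le_mul_of_nonneg_left hx.2.2 ha
      have h2 := mul_le_mul_of_nonneg_left hy.2.2 hb
      have e : a • (x, g x) + b • (y, g' y) = (a • x + b • y, a * g x + b * g' y) := by simp
      rw [e]
      exact vert_mem_segment _ (by rw [hg]; linarith) (by rw [hg]; linarith)
    have fl := h.flip (t := t) hx.1 hy.2.1 hmK.1 hmK.2.1 hK (by omega) hz hz'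
    have e1 : φ ((x, g x) ::ₘ (x, g' x) ::ₘ (y, g' y) ::ₘ t) =
        φ ((x, g x) ::ₘ (x, g' x) ::ₘ (m, g' m) ::ₘ t) +
        φ ((x, g x) ::ₘ (y, g' y) ::ₘ (m, g' m) ::ₘ t) := by
      rw [s2, s1, c1]
      congr 2
      · rw [s1, s2]
      · rw [s1, s2, s1, s2, s1, s2, s1]
    rw [e1, c2]
    have e2 : φ ((x, g x) ::ₘ (m, g m) ::ₘ (y, g' y) ::ₘ t) =
      φ ((x, g x) ::ₘ (y, g' y) ::ₘ (m, g m) ::ₘ t) := by rw [s1]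
    rw [e2]
    have e3 : φ ((x, g x) ::ₘ (m, g m) ::ₘ (m, g' m) ::ₘ t) =
      φ ((m, g m) ::ₘ (m, g' m) ::ₘ (x, g x) ::ₘ t) := by rw [s2, s1]
    rw [e3]
    calc _ = φ ((x, g x) ::ₘ (x, g' x) ::ₘ (m, g' m) ::ₘ t) +
          φ ((m, g m) ::ₘ (y, g y) ::ₘ (y, g' y) ::ₘ t) +
          (φ ((x, g x) ::ₘ (y, g' y) ::ₘ (m, g m) ::ₘ t) +
          φ ((x, g x) ::ₘ (y, g' y) ::ₘ (m, g' m) ::ₘ t)) +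
          (Pr g g' (fun s => φ ((x, g x) ::ₘ (m, g m) ::ₘ s)) l +
        Pr g g' (fun s => φ ((m, g m) ::ₘ (y, g y) ::ₘ s)) l) := by abel
      _ = _ := by rw [fl]; abel

end prism2


section diss
variable {V : Type} [AddCommGroup V] [Module ℝ V] {M : Type} [AddCommMonoid M]

/-- Convex hull of a multiset. -/
def cv (s : Multiset V) : Set V := convexHull ℝ {x | x ∈ s}

lemma mem_cv {s : Multiset V} {x : V} (h : x ∈ s) : x ∈ cv s := subset_convexHull ℝ _ h

lemma cv_convex (s : Multiset V) : Convex ℝ (cv s) := convex_convexHull ℝ _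

lemma cv_subset {s : Multiset V} {K : Set V} (hK : Convex ℝ K) (h : ∀ x ∈ s, x ∈ K) : cv s ⊆ K :=
  convexHull_min h hK

/-- The points lie in a hyperplane. -/
def Flat (s : Multiset V) : Prop := ∃ f : V →ᵃ[ℝ] ℝ, f ≠ 0 ∧ ∀ x ∈ s, f x = 0

structure IsFun (k : ℕ) (K : Set V) (φ : Multiset V → M) : Prop extends IsFun0 k K φ where
  flat : ∀ s, s.card = k → (∀ x ∈ s, x ∈ K) → Flat s → φ s = 0

/-- `s` is dissected into the members of `L`. -/
def Diss (k : ℕ) (s : Multiset V) (L : Multiset (Multiset V)) : Prop :=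
  (∀ t ∈ L, t.card = k ∧ ∀ x ∈ t, x ∈ cv s) ∧
  ∀ (M : Type) [AddCommMonoid M] (K : Set V) (φ : Multiset V → M), IsFun k K φ →
    (∀ x ∈ s, x ∈ K) → φ s = (L.map φ).sum

lemma Diss.refl {k : ℕ} {s : Multiset V} (h : s.card = k) : Diss k s {s} :=
  ⟨by simpa using ⟨h, fun x hx => mem_cv hx⟩, by intros; simp⟩

lemma Diss.of_cut {k : ℕ} {a b m : V} {t : Multiset V} (h : t.card + 2 = k)
    (hm : m ∈ segment ℝ a b) {L₁ L₂ : Multiset (Multiset V)} (h1 : Diss k (a ::ₘ m ::ₘ t) L₁)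
    (h2 : Diss k (m ::ₘ b ::ₘ t) L₂) : Diss k (a ::ₘ b ::ₘ t) (L₁ + L₂) := by
  have hmc : m ∈ cv (a ::ₘ b ::ₘ t) :=
    (cv_convex _).segment_subset (mem_cv (by simp)) (mem_cv (by simp)) hm
  have i1 : cv (a ::ₘ m ::ₘ t) ⊆ cv (a ::ₘ b ::ₘ t) := by
    apply cv_subset (cv_convex _)
    intro x hx
    simp only [Multiset.mem_cons] at hx
    rcases hx with rfl | rfl | hx
    · exact mem_cv (by simp)
    · exact hmc
    · exact mem_cv (by simp [hx])
  have i2 : cv (m ::ₘ b ::ₘ t) ⊆ cv (a ::ₘ b ::ₘ t) := by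
    apply cv_subset (cv_convex _)
    intro x hx
    simp only [Multiset.mem_cons] at hx
    rcases hx with rfl | rfl | hx
    · exact hmc
    · exact mem_cv (by simp)
    · exact mem_cv (by simp [hx])
  refine ⟨?_, ?_⟩
  · intro u hu
    rcases Multiset.mem_add.1 hu with hu | hu
    · exact ⟨(h1.1 u hu).1, fun x hx => i1 ((h1.1 u hu).2 x hx)⟩
    · exact ⟨(h2.1 u hu).1, fun x hx => i2 ((h2.1 u hu).2 x hx)⟩
  · intro M _ K φ hφ hs
    have hmK : m ∈ K := cv_subset hφ.conv hs hmc
    simp only [Multiset.mem_cons, forall_eq_or_imp] at hs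
    rw [hφ.cut a b m t hs.1 hs.2.1 hs.2.2 h hm, Multiset.map_add, Multiset.sum_add,
      h1.2 M K φ hφ (by simpa [hs.1, hmK] using hs.2.2),
      h2.2 M K φ hφ (by simpa [hs.2.1, hmK] using hs.2.2)]

lemma Diss.bind {k : ℕ} {s : Multiset V} {L : Multiset (Multiset V)} (h : Diss k s L)
    {F : Multiset V → Multiset (Multiset V)} (hF : ∀ t ∈ L, Diss k t (F t)) :
    Diss k s (L.bind F) := by
  refine ⟨?_, ?_⟩
  · intro u hu
    obtain ⟨t, ht, hu⟩ := Multiset.mem_bind.1 hu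
    exact ⟨((hF t ht).1 u hu).1,
      fun x hx => cv_subset (cv_convex _) (h.1 t ht).2 (((hF t ht).1 u hu).2 x hx)⟩
  · intro M _ K φ hφ hs
    rw [h.2 M K φ hφ hs, Multiset.map_bind, Multiset.sum_bind]
    congr 1
    apply Multiset.map_congr rfl
    intro t ht
    apply (hF t ht).2 M K φ hφ
    intro x hx
    exact cv_subset hφ.conv hs ((h.1 t ht).2 x hx)

lemma exists_cons_cons {α : Type*} {s : Multiset α} {a b : α} (ha : a ∈ s) (hb : b ∈ s) (h : a ≠ b) :
    ∃ t, s = a ::ₘ b ::ₘ t := by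
  obtain ⟨u, rfl⟩ := Multiset.exists_cons_of_mem ha
  have hb' : b ∈ u := by
    rcases Multiset.mem_cons.1 hb with h' | h'
    · exact absurd h'.symm h
    · exact h'
  obtain ⟨t, rfl⟩ := Multiset.exists_cons_of_mem hb'
  exact ⟨t, rfl⟩

lemma affine_combo (f : V →ᵃ[ℝ] ℝ) {x y : V} {a b : ℝ} (hab : a + b = 1) :
    f (a • x + b • y) = a * f x + b * f y := by
  rw [Convex.combo_affine_apply hab]; simp

/-- sign-constancy of `f` on `t` -/
def Fine1 (f : V →ᵃ[ℝ] ℝ) (t : Multiset V) : Prop := (∀ x ∈ t, 0 ≤ f x) ∨ (∀ x ∈ t, f x ≤ 0)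

lemma fine1 (k : ℕ) (f : V →ᵃ[ℝ] ℝ) : ∀ (n : ℕ) (s : Multiset V), s.card = k →
    (s.filter fun x => f x ≠ 0).card = n → ∃ L, Diss k s L ∧ ∀ t ∈ L, Fine1 f t := by
  intro n
  induction n with
  | zero =>
    intro s hs h
    refine ⟨{s}, Diss.refl hs, ?_⟩
    simp only [Multiset.mem_singleton, forall_eq]
    rw [Multiset.card_eq_zero, Multiset.filter_eq_nil] at h
    left
    intro x hx
    have := h x hx
    simp only [ne_eq, not_not] at this
    exact this.ge
  | succ n ih =>
    intro s hs h
    by_cases hp : ∃ a ∈ s, 0 < f a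
    swap
    · push Not at hp
      exact ⟨{s}, Diss.refl hs, by simp only [Multiset.mem_singleton, forall_eq]; exact Or.inr hp⟩
    by_cases hn : ∃ b ∈ s, f b < 0
    swap
    · push Not at hn
      exact ⟨{s}, Diss.refl hs, by simp only [Multiset.mem_singleton, forall_eq]; exact Or.inl hn⟩
    obtain ⟨a, ha, fa⟩ := hp
    obtain ⟨b, hb, fb⟩ := hn
    obtain ⟨t, rfl⟩ := exists_cons_cons ha hb (by rintro rfl; linarith)
    have hd : 0 < f a - f b := by linarith
    have hw : (-f b) / (f a - f b) + f a / (f a - f b) = 1 := by field_simp; ring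
    set m : V := ((-f b) / (f a - f b)) • a + (f a / (f a - f b)) • b with hm
    have fm : f m = 0 := by
      rw [hm, affine_combo f hw]; field_simp; ring
    have hseg : m ∈ segment ℝ a b :=
      ⟨_, _, div_nonneg (by linarith) hd.le, div_nonneg fa.le hd.le, hw, rfl⟩
    simp only [Multiset.card_cons] at hs
    rw [Multiset.filter_cons_of_pos (p := fun x => f x ≠ 0) _ fa.ne', Multiset.filter_cons_of_pos (p := fun x => f x ≠ 0) _ fb.ne] at h
    simp only [Multiset.card_cons] at h
    obtain ⟨L₁, d1, f1⟩ := ih (a ::ₘ m ::ₘ t) (by simp; omega) (by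
      rw [Multiset.filter_cons_of_pos (p := fun x => f x ≠ 0) _ fa.ne', Multiset.filter_cons_of_neg (p := fun x => f x ≠ 0) _ (by simpa using fm)]
      simp only [Multiset.card_cons]; omega)
    obtain ⟨L₂, d2, f2⟩ := ih (m ::ₘ b ::ₘ t) (by simp; omega) (by
      rw [Multiset.filter_cons_of_neg (p := fun x => f x ≠ 0) _ (by simpa using fm), Multiset.filter_cons_of_pos (p := fun x => f x ≠ 0) _ fb.ne]
      simp only [Multiset.card_cons]; omega)
    refine ⟨L₁ + L₂, Diss.of_cut (by omega) hseg d1 d2, ?_⟩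
    intro u hu
    rcases Multiset.mem_add.1 hu with hu | hu
    · exact f1 u hu
    · exact f2 u hu

lemma affine_nonneg_convex (f : V →ᵃ[ℝ] ℝ) : Convex ℝ {x | 0 ≤ f x} := by
  intro x hx y hy a b ha hb hab
  simp only [mem_ofPred_eq] at *
  rw [affine_combo f hab]; positivity

lemma affine_nonpos_convex (f : V →ᵃ[ℝ] ℝ) : Convex ℝ {x | f x ≤ 0} := by
  intro x hx y hy a b ha hb hab
  simp only [mem_ofPred_eq] at *
  rw [affine_combo f hab]
  have := mul_nonneg ha (neg_nonneg.2 hx)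
  have := mul_nonneg hb (neg_nonneg.2 hy)
  linarith

lemma affine_zero_convex (f : V →ᵃ[ℝ] ℝ) : Convex ℝ {x | f x = 0} := by
  intro x hx y hy a b ha hb hab
  simp only [mem_ofPred_eq] at *
  rw [affine_combo f hab, hx, hy]; ring

lemma Fine1.cv {f : V →ᵃ[ℝ] ℝ} {t : Multiset V} (h : Fine1 f t) :
    (∀ x ∈ cv t, 0 ≤ f x) ∨ (∀ x ∈ cv t, f x ≤ 0) := by
  rcases h with h | h
  · left; exact fun x hx => cv_subset (affine_nonneg_convex f) h hx
  · right; exact fun x hx => cv_subset (affine_nonpos_convex f) h hx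

lemma fine (k : ℕ) (H : List (V →ᵃ[ℝ] ℝ)) (s : Multiset V) (hs : s.card = k) :
    ∃ L, Diss k s L ∧ ∀ t ∈ L, ∀ f ∈ H, Fine1 f t := by
  induction H with
  | nil => exact ⟨{s}, Diss.refl hs, by simp⟩
  | cons f H ih =>
    obtain ⟨L, hL, hf⟩ := ih
    have : ∀ t : Multiset V, ∃ L', t ∈ L → (Diss k t L' ∧ ∀ u ∈ L', Fine1 f u) := by
      intro t
      by_cases ht : t ∈ L
      · obtain ⟨L', h⟩ := fine1 k f _ t (hL.1 t ht).1 rfl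
        exact ⟨L', fun _ => h⟩
      · exact ⟨0, fun h => absurd h ht⟩
    choose F hF using this
    refine ⟨L.bind F, hL.bind fun t ht => (hF t ht).1, ?_⟩
    intro u hu g hg
    obtain ⟨t, ht, hu⟩ := Multiset.mem_bind.1 hu
    rcases List.mem_cons.1 hg with rfl | hg
    · exact (hF t ht).2 u hu
    · have hsub := ((hF t ht).1.1 u hu).2
      rcases (hf t ht g hg).cv with h | h
      · left; exact fun x hx => h x (hsub x hx)
      · right; exact fun x hx => h x (hsub x hx)

lemma exists_fin_map {α : Type*} {k : ℕ} (s : Multiset α) (hs : s.card = k) :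
    ∃ v : Fin k → α, (Finset.univ.val.map v) = s := by
  subst hs
  obtain ⟨l, rfl⟩ := Quot.exists_rep s
  refine ⟨fun i => l.get i, ?_⟩
  have h := Fin.univ_val_map (fun i : Fin l.length => l.get i)
  rw [List.ofFn_get] at h
  exact h

lemma not_flat_span {s : Multiset V} (h : ¬ Flat s) : affineSpan ℝ {x | x ∈ s} = ⊤ := by
  by_contra hne
  apply h
  by_cases hs : s = 0
  · subst hs
    exact ⟨AffineMap.const ℝ V 1, fun h => by simpa using congrArg (fun f => f 0) h, by simp⟩
  obtain ⟨p, hp⟩ := Multiset.exists_mem_of_ne_zero hs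
  have hv : vectorSpan ℝ {x | x ∈ s} ≠ ⊤ := by
    intro h'
    exact hne ((AffineSubspace.affineSpan_eq_top_iff_vectorSpan_eq_top_of_nonempty ℝ V V ⟨p, hp⟩).2 h')
  obtain ⟨g, hg, hle⟩ := Submodule.exists_le_ker_of_lt_top _ (lt_top_iff_ne_top.2 hv)
  refine ⟨g.toAffineMap - AffineMap.const ℝ V (g p), ?_, ?_⟩
  · intro h0
    apply hg
    ext x
    have h1 := congrArg (fun f => f x) h0
    have h2 := congrArg (fun f => f 0) h0
    simp at h1 h2
    simp [h2] at h1
    simpa using h1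
  · intro x hx
    have : x -ᵥ p ∈ vectorSpan ℝ {x | x ∈ s} := vsub_mem_vectorSpan ℝ hx hp
    have := hle this
    simpa [sub_eq_zero] using this

end diss

section vert
variable {W : Type} [AddCommGroup W] [Module ℝ W]

def IsVert (t : Multiset (W × ℝ)) : Prop :=
  ∃ x a b r, a ≤ b ∧ t = (x, a) ::ₘ (x, b) ::ₘ r

lemma vert_weights (k : ℕ) : ∀ (n : ℕ) (P : Multiset (ℝ × (W × ℝ))), P.card = k →
    (P.filter fun p => p.1 ≠ 0).card = n → (P.map fun p => p.1).sum = 0 →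
    (P.map fun p => p.1 • p.2).sum = (0, 1) →
    ∃ L, Diss k (P.map fun p => p.2) L ∧ ∀ t ∈ L, IsVert t := by
  intro n
  induction n with
  | zero =>
    intro P _ h _ h2
    exfalso
    rw [Multiset.card_eq_zero, Multiset.filter_eq_nil] at h
    have : (P.map fun p => p.1 • p.2) = P.map fun p => 0 := by
      apply Multiset.map_congr rfl
      intro p hp
      have := h p hp
      simp only [ne_eq, not_not] at this
      rw [this, zero_smul]
    rw [this] at h2
    simp [Prod.ext_iff] at h2
  | succ n ih =>
    intro P hk h h1 h2
    by_cases hc : ∃ q₁ q₂ R, P = q₁ ::ₘ q₂ ::ₘ R ∧ 0 < q₁.1 * q₂.1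
    · obtain ⟨⟨l₁, a⟩, ⟨l₂, b⟩, R, rfl, hpos⟩ := hc
      simp only at hpos
      have hn1 : l₁ ≠ 0 := left_ne_zero_of_mul hpos.ne'
      have hn2 : l₂ ≠ 0 := right_ne_zero_of_mul hpos.ne'
      have hn : l₁ + l₂ ≠ 0 := by
        intro h0
        have : l₂ = -l₁ := by linarith
        rw [this] at hpos
        nlinarith [sq_nonneg l₁]
      have hw : l₁ / (l₁ + l₂) + l₂ / (l₁ + l₂) = 1 := by rw [← add_div, div_self hn]
      have hseg : (l₁ / (l₁ + l₂)) • a + (l₂ / (l₁ + l₂)) • b ∈ segment ℝ a b := by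
        refine ⟨_, _, ?_, ?_, hw, rfl⟩
        · rw [show l₁ / (l₁ + l₂) = (l₁ * l₁ + l₁ * l₂) / (l₁ + l₂)^2 by field_simp]
          have := mul_self_nonneg l₁
          positivity
        · rw [show l₂ / (l₁ + l₂) = (l₂ * l₂ + l₁ * l₂) / (l₁ + l₂)^2 by field_simp; ring]
          have := mul_self_nonneg l₂
          positivity
      set m := (l₁ / (l₁ + l₂)) • a + (l₂ / (l₁ + l₂)) • b with hm
      have hmm : (l₁ + l₂) • m = l₁ • a + l₂ • b := by
        rw [hm, smul_add, smul_smul, smul_smul]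
        congr 2 <;> field_simp
      simp only [Multiset.map_cons, Multiset.sum_cons, Multiset.card_cons] at h1 h2 hk
      rw [Multiset.filter_cons_of_pos _ (by simpa using hn1),
        Multiset.filter_cons_of_pos _ (by simpa using hn2)] at h
      simp only [Multiset.card_cons] at h
      obtain ⟨L₁, d1, f1⟩ := ih ((0, a) ::ₘ (l₁ + l₂, m) ::ₘ R) (by simp; omega) (by
        rw [Multiset.filter_cons_of_neg _ (by simp),
          Multiset.filter_cons_of_pos _ (by simpa using hn)]
        simp only [Multiset.card_cons]; omega) (by simp; linarith)
        (by simp [hmm]; rw [← h2]; abel)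
      obtain ⟨L₂, d2, f2⟩ := ih ((l₁ + l₂, m) ::ₘ (0, b) ::ₘ R) (by simp; omega) (by
        rw [Multiset.filter_cons_of_pos _ (by simpa using hn),
          Multiset.filter_cons_of_neg _ (by simp)]
        simp only [Multiset.card_cons]; omega) (by simp; linarith)
        (by simp [hmm]; rw [← h2]; abel)
      simp only [Multiset.map_cons] at d1 d2 ⊢
      refine ⟨L₁ + L₂, Diss.of_cut (by simp; omega) hseg d1 d2, ?_⟩
      intro u hu
      rcases Multiset.mem_add.1 hu with hu | hu
      · exact f1 u hu
      · exact f2 u hu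
    · push Not at hc
      have hpos : ∃ p ∈ P, 0 < p.1 := by
        by_contra hcon
        push Not at hcon
        have hz : ∀ p ∈ P, p.1 = 0 := by
          intro p hp
          obtain ⟨R, rfl⟩ := Multiset.exists_cons_of_mem hp
          have : (R.map fun p => p.1).sum ≤ 0 := by
            apply Multiset.sum_induction (p := fun x : ℝ => x ≤ 0)
            · intro a b ha hb; linarith
            · exact le_refl _
            · intro a ha
              obtain ⟨q, hq, rfl⟩ := Multiset.mem_map.1 ha
              exact hcon q (by simp [hq])
          simp only [Multiset.map_cons, Multiset.sum_cons] at h1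
          have := hcon p hp
          linarith
        have h0 : P.filter (fun p => p.1 ≠ 0) = 0 := by
          rw [Multiset.filter_eq_nil]
          intro p hp; simpa using hz p hp
        rw [h0] at h
        simp at h
      obtain ⟨p, hp, pp⟩ := hpos
      obtain ⟨R, rfl⟩ := Multiset.exists_cons_of_mem hp
      have hneg : ∃ q ∈ R, q.1 < 0 := by
        by_contra hcon
        push Not at hcon
        have : 0 ≤ (R.map fun p => p.1).sum := by
          apply Multiset.sum_nonneg
          intro a ha
          obtain ⟨q, hq, rfl⟩ := Multiset.mem_map.1 ha
          exact hcon q hq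
        simp only [Multiset.map_cons, Multiset.sum_cons] at h1
        linarith
      obtain ⟨q, hq, qn⟩ := hneg
      obtain ⟨R, rfl⟩ := Multiset.exists_cons_of_mem hq
      have hR : ∀ r ∈ R, r.1 = 0 := by
        intro r hr
        obtain ⟨R, rfl⟩ := Multiset.exists_cons_of_mem hr
        have e1 := hc p r (q ::ₘ R) (by rw [Multiset.cons_swap q r])
        have e2 := hc q r (p ::ₘ R) (by rw [Multiset.cons_swap p q, Multiset.cons_swap p r])
        rcases lt_trichotomy r.1 0 with h | h | h
        · nlinarith
        · exact h
        · nlinarith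
      have z1 : (R.map fun p => p.1).sum = 0 := by
        apply Multiset.sum_eq_zero
        intro a ha
        obtain ⟨q, hq, rfl⟩ := Multiset.mem_map.1 ha
        exact hR q hq
      have z2 : (R.map fun p => p.1 • p.2).sum = 0 := by
        apply Multiset.sum_eq_zero
        intro a ha
        obtain ⟨q, hq, rfl⟩ := Multiset.mem_map.1 ha
        simp [hR q hq]
      simp only [Multiset.map_cons, Multiset.sum_cons, z1, z2] at h1 h2
      obtain ⟨l, x, a⟩ := p
      obtain ⟨l', y, b⟩ := q
      simp only at h1 h2 pp qn
      have hl : l' = -l := by linarith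
      subst hl
      simp [Prod.ext_iff] at h2
      obtain ⟨e1, e2⟩ := h2
      have exy : x = y := by
        have : l • (x - y) = 0 := by rw [smul_sub, ← e1]; abel
        rcases smul_eq_zero.1 this with h | h
        · exact absurd h pp.ne'
        · exact sub_eq_zero.1 h
      subst exy
      refine ⟨_, Diss.refl (by rw [Multiset.card_map]; exact hk), ?_⟩
      simp only [Multiset.mem_singleton, forall_eq, Multiset.map_cons]
      refine ⟨x, b, a, R.map fun p => p.2, ?_, Multiset.cons_swap _ _ _⟩
      by_contra hlt
      push Not at hlt
      nlinarith

lemma vert_diss (k : ℕ) (s : Multiset (W × ℝ)) (hs : s.card = k) :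
    ∃ L, Diss k s L ∧ ∀ t ∈ L, IsVert t := by
  by_cases hf : Flat s
  · refine ⟨0, ⟨by simp, ?_⟩, by simp⟩
    intro M _ K φ hφ hK
    simpa using hφ.flat s hs hK hf
  · have hsp := not_flat_span hf
    obtain ⟨v, hv⟩ := exists_fin_map s hs
    have hr : {x | x ∈ s} = Set.range v := by
      ext x; rw [mem_ofPred_eq, ← hv]; simp
    rw [hr] at hsp
    have he : ((0, 1) : W × ℝ) ∈ vectorSpan ℝ (Set.range v) := by
      rw [← direction_affineSpan, hsp]; simp
    rw [mem_vectorSpan_iff_eq_weightedVSub] at he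
    obtain ⟨S, w, hw, he⟩ := he
    rw [Finset.weightedVSub_eq_linear_combination _ hw] at he
    have := vert_weights k _ (Finset.univ.val.map fun i => (if i ∈ S then w i else 0, v i))
      (by simpa using hs) rfl
      (by
        rw [Multiset.map_map]
        change ∑ i, (if i ∈ S then w i else 0) = 0
        simpa using hw)
      (by
        rw [Multiset.map_map]
        change ∑ i, (if i ∈ S then w i else 0) • v i = (0, 1)
        rw [he]
        simp [ite_smul])
    rw [Multiset.map_map] at this
    rw [← hv]
    exact this

end vert


section cuts
variable {V : Type} [AddCommGroup V] [Module ℝ V]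

lemma both_pos {α β p q : ℝ} (hα : 0 ≤ α) (hβ : 0 ≤ β) (hαβ : α + β = 1) (hp : 0 < p) (hq : 0 < q)
    (h : α * p + β * q = 0) : False := by
  have h1 := mul_nonneg hα hp.le
  have h2 := mul_nonneg hβ hq.le
  have h3 : α = 0 := by
    rcases mul_eq_zero.1 (show α * p = 0 by linarith) with h | h
    · exact h
    · exact absurd h hp.ne'
  have h4 : β = 0 := by
    rcases mul_eq_zero.1 (show β * q = 0 by linarith) with h | h
    · exact h
    · exact absurd h hq.ne'
  linarith

lemma segment_cut {a b m : V} (hm : m ∈ segment ℝ a b) :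
    segment ℝ a b = segment ℝ a m ∪ segment ℝ m b := by
  apply Subset.antisymm
  · have hr : m ∈ Set.range (AffineMap.lineMap (k := ℝ) a b) := by
      rw [segment_eq_image_lineMap] at hm
      obtain ⟨t, _, rfl⟩ := hm
      exact ⟨t, rfl⟩
    rw [← insert_endpoints_openSegment]
    intro x hx
    rcases hx with rfl | rfl | hx
    · exact Or.inl (left_mem_segment _ _ _)
    · exact Or.inr (right_mem_segment _ _ _)
    · rcases openSegment_subset_union a b hr hx with rfl | hx | hx
      · exact Or.inl (right_mem_segment _ _ _)
      · exact Or.inl (openSegment_subset_segment _ _ _ hx)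
      · exact Or.inr (openSegment_subset_segment _ _ _ hx)
  · apply Set.union_subset
    · exact (convex_segment a b).segment_subset (left_mem_segment _ _ _) hm
    · exact (convex_segment a b).segment_subset hm (right_mem_segment _ _ _)

lemma cv_pair (a b : V) (s : Multiset V) (hs : s ≠ 0) :
    cv (a ::ₘ b ::ₘ s) = convexJoin ℝ (segment ℝ a b) (cv s) := by
  have h : {x | x ∈ a ::ₘ b ::ₘ s} = ({a, b} : Set V) ∪ {x | x ∈ s} := by
    ext x; simp [or_assoc]
  obtain ⟨p, hp⟩ := Multiset.exists_mem_of_ne_zero hs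
  rw [cv, h, convexHull_union (by simp) ⟨p, hp⟩, convexHull_pair]
  rfl

lemma cv_cut {a b m : V} (s : Multiset V) (hm : m ∈ segment ℝ a b) :
    cv (a ::ₘ b ::ₘ s) = cv (a ::ₘ m ::ₘ s) ∪ cv (m ::ₘ b ::ₘ s) := by
  by_cases hs : s = 0
  · subst hs
    have h : ∀ x y : V, cv (x ::ₘ y ::ₘ 0) = segment ℝ x y := by
      intro x y
      rw [← convexHull_pair, cv]
      congr 1
      ext z; simp
    rw [h, h, h, segment_cut hm]
  · rw [cv_pair _ _ _ hs, cv_pair _ _ _ hs, cv_pair _ _ _ hs, segment_cut hm, convexJoin_union_left]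

lemma Flat.mono {s t : Multiset V} (h : Flat s) (ht : ∀ x ∈ t, x ∈ cv s) : Flat t := by
  obtain ⟨f, hf, h⟩ := h
  exact ⟨f, hf, fun x hx => cv_subset (affine_zero_convex f) h (ht x hx)⟩

lemma Flat.cv {f : V →ᵃ[ℝ] ℝ} {s : Multiset V} (h : ∀ x ∈ s, f x = 0) : ∀ x ∈ cv s, f x = 0 :=
  fun _ hx => cv_subset (affine_zero_convex f) h hx

variable [FiniteDimensional ℝ V]

lemma flat_of_card {s : Multiset V} (h : s.card ≤ Module.finrank ℝ V) : Flat s := by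
  by_contra hf
  have hsp := not_flat_span hf
  obtain ⟨v, hv⟩ := exists_fin_map s rfl
  have hr : {x | x ∈ s} = Set.range v := by
    ext x
    rw [mem_ofPred_eq, Set.mem_range]
    nth_rewrite 1 [← hv]
    simp
  rcases Nat.eq_zero_or_pos s.card with h0 | h0
  · rw [Multiset.card_eq_zero] at h0
    subst h0
    simp at hsp
  · obtain ⟨n, hn⟩ : ∃ n, s.card = n + 1 := ⟨s.card - 1, by omega⟩
    have := finrank_vectorSpan_range_le ℝ v (n := n) (by simpa using hn)
    rw [← hr, ← direction_affineSpan, hsp, AffineSubspace.direction_top, finrank_top] at this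
    omega

lemma flat_rep {a : V} {s : Multiset V} (h : s.card + 1 ≤ Module.finrank ℝ V) :
    Flat (a ::ₘ a ::ₘ s) := by
  obtain ⟨f, hf, h⟩ := flat_of_card (s := a ::ₘ s) (by simpa using h)
  exact ⟨f, hf, fun x hx => h x (by simpa using hx)⟩

lemma nonflat_basis' {s : Multiset V} (v : Fin (Module.finrank ℝ V + 1) → V)
    (hv : Finset.univ.val.map v = s) (hf : ¬ Flat s) :
    ∃ b : AffineBasis (Fin (Module.finrank ℝ V + 1)) ℝ V, (b : _ → V) = v := by
  have hsp := not_flat_span hf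
  have hr : {x | x ∈ s} = Set.range v := by
    ext x
    rw [mem_ofPred_eq, Set.mem_range, ← hv, Multiset.mem_map]
    simp only [Finset.mem_val, Finset.mem_univ, true_and]
  rw [hr] at hsp
  have hi : AffineIndependent ℝ v := by
    rw [affineIndependent_iff_finrank_vectorSpan_eq ℝ v (n := Module.finrank ℝ V) (by simp),
      ← direction_affineSpan, hsp, AffineSubspace.direction_top, finrank_top]
  exact ⟨⟨v, hi, hsp⟩, rfl⟩

lemma nonflat_basis {s : Multiset V} (hs : s.card = Module.finrank ℝ V + 1) (hf : ¬ Flat s) :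
    ∃ b : AffineBasis (Fin (Module.finrank ℝ V + 1)) ℝ V, Finset.univ.val.map b = s := by
  obtain ⟨v, hv⟩ := exists_fin_map s hs
  obtain ⟨b, rfl⟩ := nonflat_basis' v hv hf
  exact ⟨b, hv⟩

lemma cv_basis {ι : Type} [Fintype ι] (b : AffineBasis ι ℝ V) :
    cv (Finset.univ.val.map b) = {y | ∀ i, 0 ≤ b.coord i y} := by
  rw [← b.convexHull_eq_nonneg_coord, cv]
  congr 1
  ext x; simp

lemma basis_not_flat {ι : Type} [Fintype ι] (b : AffineBasis ι ℝ V) :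
    ¬ Flat (Finset.univ.val.map b) := by
  rintro ⟨f, hf, h⟩
  apply hf
  apply AffineMap.ext_on (s := Set.range b) b.tot
  rintro _ ⟨i, rfl⟩
  simpa using h (b i) (by simp)

lemma cv_eq_halfspaces {s : Multiset V} (hs : s.card = Module.finrank ℝ V + 1) (hf : ¬ Flat s) :
    ∃ H : List (V →ᵃ[ℝ] ℝ), (∀ f ∈ H, f ≠ 0) ∧ cv s = {y | ∀ f ∈ H, 0 ≤ f y} := by
  obtain ⟨b, rfl⟩ := nonflat_basis hs hf
  refine ⟨List.ofFn b.coord, ?_, ?_⟩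
  · intro f hf h0
    obtain ⟨i, rfl⟩ := (List.mem_ofFn' _ _).1 hf
    have := b.coord_apply_eq i
    rw [h0] at this
    simp at this
  · rw [cv_basis]
    ext y
    simp only [mem_ofPred_eq]
    constructor
    · intro h f hf
      obtain ⟨i, rfl⟩ := (List.mem_ofFn' _ _).1 hf
      exact h i
    · intro h i
      exact h _ ((List.mem_ofFn' _ _).2 ⟨i, rfl⟩)

/-- indicator -/
def iota {α : Type} (A : Set α) (x : α) : ℕ := if x ∈ A then 1 else 0

end cuts

section meas
variable {V : Type} [NormedAddCommGroup V] [NormedSpace ℝ V] [FiniteDimensional ℝ V]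
  [MeasurableSpace V] [BorelSpace V] (μ : Measure V) [μ.IsAddHaarMeasure]

lemma null_hyper {f : V →ᵃ[ℝ] ℝ} (hf : f ≠ 0) : ∀ᵐ x ∂μ, f x ≠ 0 := by
  rw [ae_iff]
  have hh : {x | ¬ f x ≠ 0} = ((affineSpan ℝ {(0:ℝ)}).comap f : Set V) := by
    ext x
    simp
  rw [hh]
  apply Measure.addHaar_affineSubspace
  intro ht
  apply hf
  ext x
  have : x ∈ (affineSpan ℝ {(0:ℝ)}).comap f := by rw [ht]; trivial
  simpa using this

lemma flat_null {s : Multiset V} (h : Flat s) : ∀ᵐ x ∂μ, x ∉ cv s := by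
  obtain ⟨f, hf, h⟩ := h
  filter_upwards [null_hyper μ hf] with x hx hx'
  exact hx (Flat.cv h x hx')

lemma nonflat_pos {s : Multiset V} (h : ¬ Flat s) : μ (cv s) ≠ 0 := by
  have h1 := not_flat_span h
  rw [← interior_convexHull_nonempty_iff_affineSpan_eq_top] at h1
  exact ((isOpen_interior.measure_pos μ h1).trans_le (measure_mono interior_subset)).ne'

def chi (s : Multiset V) : Filter.Germ (ae μ) ℕ := ((fun x => iota (cv s) x : V → ℕ) : Filter.Germ (ae μ) ℕ)

lemma cut_ae {a b m : V} {s : Multiset V} (hs : s.card + 2 = Module.finrank ℝ V + 1)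
    (hm : m ∈ segment ℝ a b) :
    ∀ᵐ x ∂μ, iota (cv (a ::ₘ b ::ₘ s)) x = iota (cv (a ::ₘ m ::ₘ s)) x + iota (cv (m ::ₘ b ::ₘ s)) x := by
  obtain ⟨f, hf, h⟩ := flat_of_card (s := m ::ₘ s) (by simp; omega)
  have hmz := h m (by simp)
  by_cases hbad : ∀ᵐ x ∂μ, x ∉ cv (a ::ₘ m ::ₘ s) ∨ x ∉ cv (m ::ₘ b ::ₘ s)
  · filter_upwards [hbad] with x hx
    rw [cv_cut s hm]
    simp only [iota, mem_union]
    by_cases h1 : x ∈ cv (a ::ₘ m ::ₘ s) <;> by_cases h2 : x ∈ cv (m ::ₘ b ::ₘ s) <;> simp_all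
  exfalso
  apply hbad
  have key : ∀ f : V →ᵃ[ℝ] ℝ, f ≠ 0 → (∀ x ∈ m ::ₘ s, f x = 0) → 0 ≤ f a → f b ≤ 0 →
      ∀ᵐ x ∂μ, x ∉ cv (a ::ₘ m ::ₘ s) ∨ x ∉ cv (m ::ₘ b ::ₘ s) := by
    intro f hf h ha hb
    filter_upwards [null_hyper μ hf] with x hx
    by_contra hcon
    push Not at hcon
    have h1 := cv_subset (affine_nonneg_convex f) (K := {x | 0 ≤ f x}) (by
      intro y hy
      rcases Multiset.mem_cons.1 hy with rfl | hy
      · exact ha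
      · exact (h y hy).ge) hcon.1
    have h2 := cv_subset (affine_nonpos_convex f) (K := {x | f x ≤ 0}) (by
      intro y hy
      simp only [Multiset.mem_cons] at hy
      rcases hy with rfl | rfl | hy
      · exact (h y (by simp)).le
      · exact hb
      · exact (h y (by simp [hy])).le) hcon.2
    exact hx (le_antisymm h2 h1)
  obtain ⟨α, β, hα, hβ, hαβ, rfl⟩ := hm
  rw [affine_combo f hαβ] at hmz
  by_cases h0 : Flat (a ::ₘ (α • a + β • b) ::ₘ s)
  · filter_upwards [flat_null μ h0] with x hx using Or.inl hx
  by_cases h0' : Flat ((α • a + β • b) ::ₘ b ::ₘ s)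
  · filter_upwards [flat_null μ h0'] with x hx using Or.inr hx
  have fa : f a ≠ 0 := fun h' => h0 ⟨f, hf, fun x hx => by
    rcases Multiset.mem_cons.1 hx with rfl | hx
    · exact h'
    · exact h x hx⟩
  have fb : f b ≠ 0 := fun h' => h0' ⟨f, hf, fun x hx => by
    simp only [Multiset.mem_cons] at hx
    rcases hx with rfl | rfl | hx
    · exact h _ (by simp)
    · exact h'
    · exact h x (by simp [hx])⟩
  rcases lt_or_gt_of_ne fa with ha | ha
  · apply key (-f) (neg_ne_zero.2 hf) (fun x hx => by simp [h x hx])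
    · simpa using ha.le
    · simp only [AffineMap.coe_neg, Pi.neg_apply]
      by_contra hb
      have hb : f b < 0 := by linarith
      exact both_pos hα hβ hαβ (neg_pos.2 ha) (neg_pos.2 hb) (by linarith)
  · apply key f hf h ha.le
    by_contra hb
    push Not at hb
    exact both_pos hα hβ hαβ ha hb hmz

lemma iota_flat_ae {s : Multiset V} (h : Flat s) : ∀ᵐ x ∂μ, iota (cv s) x = 0 := by
  filter_upwards [flat_null μ h] with x hx
  simp [iota, hx]

lemma chi_isFun : IsFun (Module.finrank ℝ V + 1) (univ : Set V) (chi μ) where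
  conv := convex_univ
  rep := by
    intro a s _ _ hs
    apply Filter.Germ.coe_eq.2
    exact iota_flat_ae μ (flat_rep (by omega))
  cut := by
    intro a b m s _ _ _ hs hm
    apply Filter.Germ.coe_eq.2
    exact cut_ae μ hs hm
  flat := by
    intro s _ _ h
    apply Filter.Germ.coe_eq.2
    exact iota_flat_ae μ h

lemma sum_chi {β : Type} (L : Multiset β) (F : β → V → ℕ) :
    (L.map fun b => ((F b : V → ℕ) : Filter.Germ (ae μ) ℕ)).sum
      = ((fun x => (L.map fun b => F b x).sum : V → ℕ) : Filter.Germ (ae μ) ℕ) := by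
  induction L using Multiset.induction with
  | empty => simp; rfl
  | cons b L ih => simp only [Multiset.map_cons, Multiset.sum_cons, ih]; rfl

lemma Diss.ae {s : Multiset V} {L : Multiset (Multiset V)}
    (h : Diss (Module.finrank ℝ V + 1) s L) :
    ∀ᵐ x ∂μ, iota (cv s) x = (L.map fun t => iota (cv t) x).sum := by
  have := h.2 _ univ (chi μ) (chi_isFun μ) (by simp)
  unfold chi at this
  rw [sum_chi μ L (fun t x => iota (cv t) x)] at this
  exact Filter.Germ.coe_eq.1 this

/-- The main property: an additive functional on simplices only depends on indicator sums. -/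
def PStar : Prop :=
  ∀ (M : Type) [AddCommMonoid M] (K : Set V) (φ : Multiset V → M),
    IsFun (Module.finrank ℝ V + 1) K φ → ∀ L L' : Multiset (Multiset V),
    (∀ s ∈ L, s.card = Module.finrank ℝ V + 1 ∧ ∀ x ∈ s, x ∈ K) →
    (∀ s ∈ L', s.card = Module.finrank ℝ V + 1 ∧ ∀ x ∈ s, x ∈ K) →
    (∀ᵐ x ∂μ, (L.map fun s => iota (cv s) x).sum = (L'.map fun s => iota (cv s) x).sum) →
    (L.map φ).sum = (L'.map φ).sum

end meas


section triples
variable {W : Type} [AddCommGroup W] [Module ℝ W]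

/-- A prism: base simplex, lower and upper sheet. -/
structure Tri (W : Type) [AddCommGroup W] [Module ℝ W] where
  D : Multiset W
  g : W →ᵃ[ℝ] ℝ
  g' : W →ᵃ[ℝ] ℝ

def Tri.R (τ : Tri W) : Set (W × ℝ) := {p | p.1 ∈ cv τ.D ∧ τ.g p.1 ≤ p.2 ∧ p.2 ≤ τ.g' p.1}

lemma flat_fst {t : Multiset (W × ℝ)} (h : Flat (t.map Prod.fst)) : Flat t := by
  obtain ⟨f, hf, h⟩ := h
  refine ⟨f.comp (LinearMap.fst ℝ W ℝ).toAffineMap, ?_, ?_⟩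
  · intro h0
    apply hf
    ext x
    exact congrArg (fun F => F (x, 0)) h0
  · intro p hp
    exact h p.1 (Multiset.mem_map_of_mem _ hp)

lemma graph_convex (g : W →ᵃ[ℝ] ℝ) {K : Set (W × ℝ)} (hK : Convex ℝ K) :
    Convex ℝ {y | (y, g y) ∈ K} := by
  rw [convex_iff_segment_subset]
  intro x hx y hy z hz
  exact hK.segment_subset hx hy (graph_segment g hz)

variable [FiniteDimensional ℝ W]

lemma sheet {q : Multiset (W × ℝ)} (hq : q.card = Module.finrank ℝ W + 1)
    (hf : ¬ Flat (q.map Prod.fst)) : ∃ g : W →ᵃ[ℝ] ℝ, ∀ p ∈ q, g p.1 = p.2 := by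
  obtain ⟨v, hv⟩ := exists_fin_map q hq
  obtain ⟨b, hb⟩ := nonflat_basis' (s := q.map Prod.fst) (fun i => (v i).1) (by
    rw [← hv, Multiset.map_map]; rfl) hf
  refine ⟨∑ i, (v i).2 • b.coord i, ?_⟩
  intro p hp
  rw [← hv] at hp
  obtain ⟨i, _, rfl⟩ := Multiset.mem_map.1 hp
  rw [show (v i).1 = b i by rw [hb]]
  have : ∀ (S : Finset (Fin (Module.finrank ℝ W + 1))) (z : W),
      (∑ i ∈ S, (v i).2 • b.coord i) z = ∑ i ∈ S, (v i).2 * b.coord i z := by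
    intro S z
    induction S using Finset.induction with
    | empty => simp
    | insert a S ha ih => rw [Finset.sum_insert ha, Finset.sum_insert ha, ← ih]; simp
  rw [this]
  simp [AffineBasis.coord_apply]

lemma vert_triple {t : Multiset (W × ℝ)} (ht : t.card = Module.finrank ℝ W + 2) (hv : IsVert t)
    (hf : ¬ Flat t) : ∃ τ : Tri W, τ.D.card = Module.finrank ℝ W + 1 ∧ ¬ Flat τ.D ∧
      (∀ y ∈ τ.D, τ.g y ≤ τ.g' y ∧ (y, τ.g y) ∈ t ∧ (y, τ.g' y) ∈ t) ∧
      (∀ (M : Type) [AddCommMonoid M] (K : Set (W × ℝ)) (φ : Multiset (W × ℝ) → M),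
        IsFun (Module.finrank ℝ W + 2) K φ → (∀ x ∈ t, x ∈ K) → φ t = PrM τ.g τ.g' φ τ.D) ∧
      cv t = τ.R := by
  obtain ⟨x, a, b, r, hab, rfl⟩ := hv
  simp only [Multiset.card_cons] at ht
  have hD : ¬ Flat (x ::ₘ r.map Prod.fst) := by
    intro h
    apply hf
    apply flat_fst
    obtain ⟨f, hf, h⟩ := h
    exact ⟨f, hf, fun y hy => h y (by simpa using hy)⟩
  obtain ⟨g, hg⟩ := sheet (q := (x, a) ::ₘ r) (by simp; omega) (by simpa using hD)
  obtain ⟨g', hg'⟩ := sheet (q := (x, b) ::ₘ r) (by simp; omega) (by simpa using hD)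
  have hgx : g x = a := hg (x, a) (by simp)
  have hgx' : g' x = b := hg' (x, b) (by simp)
  have hgr : ∀ p ∈ r, g p.1 = p.2 := fun p hp => hg p (by simp [hp])
  have hgr' : ∀ p ∈ r, g' p.1 = p.2 := fun p hp => hg' p (by simp [hp])
  have hpt : ∀ y ∈ x ::ₘ r.map Prod.fst, g y ≤ g' y ∧ (y, g y) ∈ (x, a) ::ₘ (x, b) ::ₘ r ∧
      (y, g' y) ∈ (x, a) ::ₘ (x, b) ::ₘ r := by
    intro y hy
    rcases Multiset.mem_cons.1 hy with rfl | hy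
    · rw [hgx, hgx']; exact ⟨hab, by simp, by simp⟩
    · obtain ⟨p, hp, rfl⟩ := Multiset.mem_map.1 hy
      rw [hgr p hp, hgr' p hp]
      exact ⟨le_rfl, by simp [hp], by simp [hp]⟩
  refine ⟨⟨x ::ₘ r.map Prod.fst, g, g'⟩, by simp; omega, hD, hpt, ?_, ?_⟩
  · intro M _ K φ hφ hK
    obtain ⟨l, rfl⟩ := Quot.exists_rep r
    change Multiset.card (l : Multiset (W × ℝ)) + 1 + 1 = _ at ht
    rw [Multiset.coe_card] at ht
    have hK' : ∀ y ∈ x :: l.map Prod.fst, y ∈ PrK g g' K := by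
      intro y hy
      have := hpt y hy
      exact ⟨hK _ this.2.1, hK _ this.2.2, this.1⟩
    have e1 : PrM g g' φ (x ::ₘ Multiset.map Prod.fst (Quot.mk _ l)) =
        Pr g g' φ (x :: l.map Prod.fst) :=
      PrM_coe hφ.toIsFun0 (by simp; omega) hK'
    have hgl : gl g' (l.map Prod.fst) = (l : Multiset (W × ℝ)) := by
      unfold gl
      rw [List.map_map]
      congr 1
      conv_rhs => rw [← List.map_id l]
      apply List.map_congr_left
      intro p hp
      simp [hgr' p hp]
    change _ = PrM g g' φ (x ::ₘ Multiset.map Prod.fst (Quot.mk _ l))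
    rw [e1, Pr_cons, hgl, hgx, hgx', Pr_eq_zero (l.map Prod.fst)
      (hφ.toIsFun0.cone (a := (x, a)) (hK _ (by simp))) (by simp; omega)
      (fun y hy => hK' y (by simp [hy])), add_zero]
    · rfl
    · intro y hy
      obtain ⟨p, hp, rfl⟩ := List.mem_map.1 hy
      rw [hgr p hp, hgr' p hp]
  · apply Subset.antisymm
    · have hcx : Convex ℝ (Tri.R ⟨x ::ₘ r.map Prod.fst, g, g'⟩) := by
        intro p hp q hq α β hα hβ hαβ
        refine ⟨?_, ?_, ?_⟩
        · exact cv_convex _ hp.1 hq.1 hα hβ hαβ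
        · have h1 := mul_le_mul_of_nonneg_left hp.2.1 hα
          have h2 := mul_le_mul_of_nonneg_left hq.2.1 hβ
          change g (α • p.1 + β • q.1) ≤ α * p.2 + β * q.2
          rw [affine_combo g hαβ]
          exact add_le_add h1 h2
        · have h1 := mul_le_mul_of_nonneg_left hp.2.2 hα
          have h2 := mul_le_mul_of_nonneg_left hq.2.2 hβ
          change α * p.2 + β * q.2 ≤ g' (α • p.1 + β • q.1)
          rw [affine_combo g' hαβ]
          exact add_le_add h1 h2
      apply cv_subset hcx
      intro p hp
      simp only [Multiset.mem_cons] at hp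
      rcases hp with rfl | rfl | hp
      · exact ⟨mem_cv (by simp), hgx.le, hgx'.symm ▸ hab⟩
      · exact ⟨mem_cv (by simp), hgx.symm ▸ hab, hgx'.ge⟩
      · exact ⟨mem_cv (Multiset.mem_cons_of_mem (Multiset.mem_map_of_mem _ hp)),
          (hgr p hp).le, (hgr' p hp).ge⟩
    · rintro ⟨y, h⟩ ⟨hy, h1, h2⟩
      have k1 : (y, g y) ∈ cv ((x, a) ::ₘ (x, b) ::ₘ r) :=
        cv_subset (graph_convex g (cv_convex _)) (fun z hz => mem_cv (hpt z hz).2.1) hy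
      have k2 : (y, g' y) ∈ cv ((x, a) ::ₘ (x, b) ::ₘ r) :=
        cv_subset (graph_convex g' (cv_convex _)) (fun z hz => mem_cv (hpt z hz).2.2) hy
      exact (cv_convex _).segment_subset k1 k2 (vert_mem_segment y h1 h2)

lemma sum_filter_zero {β M : Type} [AddCommMonoid M] (L : Multiset β) (p : β → Prop)
    [DecidablePred p] (F : β → M)
    (h : ∀ b ∈ L, ¬ p b → F b = 0) : (L.map F).sum = ((L.filter p).map F).sum := by
  induction L using Multiset.induction with
  | empty => simp
  | cons b L ih =>
    have ih' := ih fun c hc => h c (Multiset.mem_cons_of_mem hc)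
    by_cases hb : p b
    · rw [Multiset.filter_cons_of_pos _ hb]; simp [ih']
    · rw [Multiset.filter_cons_of_neg _ hb]; simp [ih', h b (by simp) hb]

/-- A good prism with graph points in `K`. -/
def Tri.Good (τ : Tri W) (K : Set (W × ℝ)) : Prop :=
  τ.D.card = Module.finrank ℝ W + 1 ∧ ¬ Flat τ.D ∧ ∀ y ∈ τ.D, y ∈ PrK τ.g τ.g' K

end triples

section triples2
variable {W : Type} [NormedAddCommGroup W] [NormedSpace ℝ W] [FiniteDimensional ℝ W]
  [MeasurableSpace W] [BorelSpace W] (ν : Measure (W × ℝ)) [ν.IsAddHaarMeasure]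

lemma triples (s : Multiset (W × ℝ)) (hs : s.card = Module.finrank ℝ W + 2) :
    ∃ Λ : Multiset (Tri W), (∀ τ ∈ Λ, τ.Good (cv s)) ∧
      (∀ (M : Type) [AddCommMonoid M] (K : Set (W × ℝ)) (φ : Multiset (W × ℝ) → M),
        IsFun (Module.finrank ℝ W + 2) K φ → (∀ x ∈ s, x ∈ K) →
        φ s = (Λ.map fun τ => PrM τ.g τ.g' φ τ.D).sum) ∧
      ∀ᵐ p ∂ν, iota (cv s) p = (Λ.map fun τ => iota τ.R p).sum := by
  obtain ⟨L, hL, hv⟩ := vert_diss _ s hs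
  have hfr : Module.finrank ℝ (W × ℝ) + 1 = Module.finrank ℝ W + 2 := by simp
  have : ∀ t : Multiset (W × ℝ), ∃ τ : Tri W, t ∈ L.filter (fun t => ¬ Flat t) →
      τ.D.card = Module.finrank ℝ W + 1 ∧ ¬ Flat τ.D ∧
      (∀ y ∈ τ.D, τ.g y ≤ τ.g' y ∧ (y, τ.g y) ∈ t ∧ (y, τ.g' y) ∈ t) ∧
      (∀ (M : Type) [AddCommMonoid M] (K : Set (W × ℝ)) (φ : Multiset (W × ℝ) → M),
        IsFun (Module.finrank ℝ W + 2) K φ → (∀ x ∈ t, x ∈ K) → φ t = PrM τ.g τ.g' φ τ.D) ∧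
      cv t = τ.R := by
    intro t
    by_cases ht : t ∈ L.filter (fun t => ¬ Flat t)
    · rw [Multiset.mem_filter] at ht
      obtain ⟨τ, h⟩ := vert_triple (hL.1 t ht.1).1 (hv t ht.1) ht.2
      exact ⟨τ, fun _ => h⟩
    · exact ⟨⟨0, 0, 0⟩, fun h => absurd h ht⟩
  choose T hT using this
  refine ⟨(L.filter fun t => ¬ Flat t).map T, ?_, ?_, ?_⟩
  · intro τ hτ
    obtain ⟨t, ht, rfl⟩ := Multiset.mem_map.1 hτ
    obtain ⟨h1, h2, h3, -⟩ := hT t ht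
    refine ⟨h1, h2, fun y hy => ?_⟩
    have hsub := (hL.1 t (Multiset.mem_filter.1 ht).1).2
    exact ⟨hsub _ (h3 y hy).2.1, hsub _ (h3 y hy).2.2, (h3 y hy).1⟩
  · intro M _ K φ hφ hK
    have hsub : ∀ t ∈ L, ∀ x ∈ t, x ∈ K := fun t ht x hx =>
      cv_subset hφ.conv hK ((hL.1 t ht).2 x hx)
    rw [hL.2 M K φ hφ hK, sum_filter_zero L (fun t => ¬ Flat t), Multiset.map_map]
    · congr 1
      apply Multiset.map_congr rfl
      intro t ht
      exact (hT t ht).2.2.2.1 M K φ hφ (hsub t (Multiset.mem_filter.1 ht).1)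
    · intro t ht hf
      push Not at hf
      exact hφ.flat t (hL.1 t ht).1 (hsub t ht) hf
  · have h1 : ∀ᵐ p ∂ν, ∀ t ∈ L, Flat t → iota (cv t) p = 0 := by
      have : ∀ᵐ p ∂ν, ∀ t ∈ {t | t ∈ L}, Flat t → iota (cv t) p = 0 := by
        rw [ae_ball_iff (Multiset.finite_toSet L).countable]
        intro t _
        by_cases hf : Flat t
        · filter_upwards [iota_flat_ae ν hf] with p hp using fun _ => hp
        · exact Filter.Eventually.of_forall fun p h => absurd h hf
      exact this
    filter_upwards [h1, Diss.ae ν (hfr ▸ hL)] with p hp1 hp2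
    rw [hp2, sum_filter_zero L (fun t => ¬ Flat t), Multiset.map_map]
    · congr 1
      apply Multiset.map_congr rfl
      intro t ht
      simp only [Function.comp]
      rw [(hT t ht).2.2.2.2]
    · intro t ht hf
      push Not at hf
      exact hp1 t ht hf

end triples2


section onedim
variable {M : Type} [AddCommMonoid M]

lemma elem_intervals (ψ : ℝ → ℝ → M) (A : Finset ℝ) : (∀ a ∈ A, ψ a a = 0) →
    (∀ a ∈ A, ∀ b ∈ A, ∀ c ∈ A, a ≤ b → b ≤ c → ψ a c = ψ a b + ψ b c) →
    ∃ E : Multiset (ℝ × ℝ), (∀ e ∈ E, e.1 < e.2 ∧ ∀ x ∈ A, x ≤ e.1 ∨ e.2 ≤ x) ∧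
      ∀ a ∈ A, ∀ b ∈ A, a ≤ b →
        ψ a b = (E.map fun e => if a ≤ e.1 ∧ e.2 ≤ b then ψ e.1 e.2 else 0).sum := by
  induction A using Finset.induction_on_max with
  | empty => intro _ _; exact ⟨0, by simp, by simp⟩
  | insert z A hz ih =>
    intro h0 hadd
    obtain ⟨E, hE, hs⟩ := ih (fun a ha => h0 a (by simp [ha]))
      (fun a ha b hb c hc => hadd a (by simp [ha]) b (by simp [hb]) c (by simp [hc]))
    by_cases hA : A.Nonempty
    swap
    · rw [Finset.not_nonempty_iff_eq_empty] at hA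
      subst hA
      refine ⟨0, by simp, ?_⟩
      simpa using h0
    set w := A.max' hA with hw
    have hwA : w ∈ A := A.max'_mem hA
    have hwm : ∀ x ∈ A, x ≤ w := fun x hx => A.le_max' x hx
    have hwz : w < z := hz w hwA
    refine ⟨(w, z) ::ₘ E.filter (fun e => e.2 ≤ w), ?_, ?_⟩
    · intro e he
      rcases Multiset.mem_cons.1 he with rfl | he
      · refine ⟨hwz, fun x hx => ?_⟩
        rcases Finset.mem_insert.1 hx with rfl | hx
        · exact Or.inr le_rfl
        · exact Or.inl (hwm x hx)
      · obtain ⟨he1, he2⟩ := Multiset.mem_filter.1 he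
        refine ⟨(hE e he1).1, fun x hx => ?_⟩
        rcases Finset.mem_insert.1 hx with rfl | hx
        · exact Or.inr (he2.trans hwz.le)
        · exact (hE e he1).2 x hx
    · have key : ∀ a ∈ A, ∀ b ∈ A, a ≤ b → ψ a b =
          ((E.filter (fun e => e.2 ≤ w)).map
            fun e => if a ≤ e.1 ∧ e.2 ≤ b then ψ e.1 e.2 else 0).sum := by
        intro a ha b hb hab
        rw [hs a ha b hb hab]
        apply sum_filter_zero
        intro e _ hne
        rw [if_neg]
        rintro ⟨_, h⟩
        exact hne (h.trans (hwm b hb))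
      intro a ha b hb hab
      rw [Multiset.map_cons, Multiset.sum_cons]
      rcases Finset.mem_insert.1 ha with rfl | ha'
      · rcases Finset.mem_insert.1 hb with rfl | hb'
        · rw [h0 b ha, if_neg (by simp; exact hwz), zero_add]
          symm
          apply Multiset.sum_eq_zero
          intro x hx
          obtain ⟨e, he, rfl⟩ := Multiset.mem_map.1 hx
          rw [Multiset.mem_filter] at he
          rw [if_neg]
          rintro ⟨h1, h2⟩
          linarith [(hE e he.1).1]
        · exact absurd hab (not_le.2 (hz b hb'))
      · rcases Finset.mem_insert.1 hb with rfl | hb'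
        · rw [if_pos ⟨hwm a ha', le_rfl⟩, hadd a ha w (by simp [hwA]) b hb (hwm a ha') hwz.le,
            key a ha' w hwA (hwm a ha'), add_comm]
          congr 2
          apply Multiset.map_congr rfl
          intro e he
          rw [Multiset.mem_filter] at he
          have : e.2 ≤ b := he.2.trans hwz.le
          simp [he.2, this]
        · rw [if_neg (by rintro ⟨_, h⟩; exact absurd h (not_le.2 (hz b hb'))), zero_add]
          exact key a ha' b hb' hab

lemma sum_ite_smul {β : Type} (P : Multiset β) (p : β → Prop) [DecidablePred p] (m : M) :
    (P.map fun b => if p b then m else 0).sum = (P.map fun b => if p b then 1 else 0).sum • m := by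
  induction P using Multiset.induction with
  | empty => simp
  | cons b P ih =>
    simp only [Multiset.map_cons, Multiset.sum_cons, ih]
    by_cases h : p b <;> simp [h, add_smul]

lemma one_dim (ψ : ℝ → ℝ → M) (A : Finset ℝ) (h0 : ∀ a ∈ A, ψ a a = 0)
    (hadd : ∀ a ∈ A, ∀ b ∈ A, ∀ c ∈ A, a ≤ b → b ≤ c → ψ a c = ψ a b + ψ b c)
    (P P' : Multiset (ℝ × ℝ)) (hP : ∀ p ∈ P, p.1 ∈ A ∧ p.2 ∈ A ∧ p.1 ≤ p.2)
    (hP' : ∀ p ∈ P', p.1 ∈ A ∧ p.2 ∈ A ∧ p.1 ≤ p.2)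
    (hae : ∀ᵐ h : ℝ, (P.map fun p => iota (Icc p.1 p.2) h).sum
      = (P'.map fun p => iota (Icc p.1 p.2) h).sum) :
    (P.map fun p => ψ p.1 p.2).sum = (P'.map fun p => ψ p.1 p.2).sum := by
  obtain ⟨E, hE, hs⟩ := elem_intervals ψ A h0 hadd
  have key : ∀ P : Multiset (ℝ × ℝ), (∀ p ∈ P, p.1 ∈ A ∧ p.2 ∈ A ∧ p.1 ≤ p.2) →
      (P.map fun p => ψ p.1 p.2).sum = (E.map fun e =>
        (P.map fun p => if p.1 ≤ e.1 ∧ e.2 ≤ p.2 then 1 else 0).sum • ψ e.1 e.2).sum := by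
    intro P hP
    have : (P.map fun p => ψ p.1 p.2) = P.map fun p =>
        (E.map fun e => if p.1 ≤ e.1 ∧ e.2 ≤ p.2 then ψ e.1 e.2 else 0).sum := by
      apply Multiset.map_congr rfl
      intro p hp
      exact hs _ (hP p hp).1 _ (hP p hp).2.1 (hP p hp).2.2
    rw [this, Multiset.sum_map_sum_map]
    congr 1
    apply Multiset.map_congr rfl
    intro e _
    exact sum_ite_smul P (fun p : ℝ × ℝ => p.1 ≤ e.1 ∧ e.2 ≤ p.2) (ψ e.1 e.2)
  rw [key P hP, key P' hP']
  congr 1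
  apply Multiset.map_congr rfl
  intro e he
  congr 1
  obtain ⟨hlt, hno⟩ := hE e he
  have hex : ∃ h ∈ Ioo e.1 e.2, (P.map fun p => iota (Icc p.1 p.2) h).sum
      = (P'.map fun p => iota (Icc p.1 p.2) h).sum := by
    by_contra hcon
    push Not at hcon
    have : ∀ᵐ h : ℝ, h ∉ Ioo e.1 e.2 := by
      filter_upwards [hae] with h hh hmem using hcon h hmem hh
    rw [← measure_eq_zero_iff_ae_notMem, Real.volume_Ioo, ENNReal.ofReal_eq_zero] at this
    linarith
  obtain ⟨h, hmem, hh⟩ := hex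
  have conv : ∀ P : Multiset (ℝ × ℝ), (∀ p ∈ P, p.1 ∈ A ∧ p.2 ∈ A ∧ p.1 ≤ p.2) →
      (P.map fun p => if p.1 ≤ e.1 ∧ e.2 ≤ p.2 then 1 else 0).sum
        = (P.map fun p => iota (Icc p.1 p.2) h).sum := by
    intro P hP
    congr 1
    apply Multiset.map_congr rfl
    intro p hp
    unfold iota
    congr 1
    apply propext
    constructor
    · rintro ⟨h1, h2⟩
      exact ⟨h1.trans hmem.1.le, hmem.2.le.trans h2⟩
    · rintro ⟨h1, h2⟩
      refine ⟨(hno _ (hP p hp).1).resolve_right fun h' => ?_,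
        (hno _ (hP p hp).2.1).resolve_left fun h' => ?_⟩
      · linarith [hmem.2]
      · linarith [hmem.1]
  rw [conv P hP, conv P' hP', hh]

end onedim

section prflat
variable {W : Type} [AddCommGroup W] [Module ℝ W] {M : Type} [AddCommMonoid M]

lemma PrM_isFun {g g' : W →ᵃ[ℝ] ℝ} {K : Set (W × ℝ)} {k : ℕ}
    {φ : Multiset (W × ℝ) → M} (h : IsFun (k + 1) K φ) :
    IsFun k (PrK g g' K) (PrM g g' φ) where
  toIsFun0 := PrM_isFun0 h.toIsFun0
  flat := by
    intro D hD hK hf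
    apply Pr_zero
    intro s hs hmem
    have hl : ∀ y ∈ D.toList, y ∈ PrK g g' K := fun y hy => hK y (Multiset.mem_toList.1 hy)
    apply h.flat s (by rw [hs]; simp [hD]) (mem_graph_of hl hmem)
    obtain ⟨f, hf, h⟩ := hf
    apply flat_fst
    refine ⟨f, hf, ?_⟩
    intro x hx
    obtain ⟨p, hp, rfl⟩ := Multiset.mem_map.1 hx
    obtain ⟨y, hy, rfl | rfl⟩ := hmem p hp
    · exact h y (Multiset.mem_toList.1 hy)
    · exact h y (Multiset.mem_toList.1 hy)

lemma PrM_stack {g g' g'' : W →ᵃ[ℝ] ℝ} {K : Set (W × ℝ)} {k : ℕ}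
    {φ : Multiset (W × ℝ) → M} (h : IsFun (k + 1) K φ) {D : Multiset W} (hD : D.card = k)
    (h1 : ∀ y ∈ D, y ∈ PrK g g' K) (h2 : ∀ y ∈ D, y ∈ PrK g' g'' K) :
    PrM g g'' φ D = PrM g g' φ D + PrM g' g'' φ D :=
  Pr_stack _ h.toIsFun0 (by simp [hD]) (fun y hy => h1 y (Multiset.mem_toList.1 hy))
    (fun y hy => h2 y (Multiset.mem_toList.1 hy))

lemma PrM_self {g : W →ᵃ[ℝ] ℝ} {K : Set (W × ℝ)} {k : ℕ}
    {φ : Multiset (W × ℝ) → M} (h : IsFun (k + 1) K φ) {D : Multiset W} (hD : D.card = k)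
    (h1 : ∀ y ∈ D, y ∈ PrK g g K) : PrM g g φ D = 0 :=
  Pr_eq_zero _ h.toIsFun0 (by simp [hD]) (fun y hy => h1 y (Multiset.mem_toList.1 hy))
    (fun _ _ => rfl)

end prflat

section big
variable {V : Type} [NormedAddCommGroup V] [NormedSpace ℝ V] [FiniteDimensional ℝ V]

lemma big_simplex (F : Multiset V) : ∃ B : Multiset V, B.card = Module.finrank ℝ V + 1 ∧
    ∀ x ∈ F, x ∈ cv B := by
  obtain ⟨⟨b⟩⟩ : Nonempty (Nonempty (AffineBasis (Fin (Module.finrank ℝ V + 1)) ℝ V)) :=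
    ⟨AffineBasis.exists_affineBasis_of_finiteDimensional (by simp)⟩
  have hinter : (interior (convexHull ℝ (Set.range b))).Nonempty := by
    rw [interior_convexHull_nonempty_iff_affineSpan_eq_top]; exact b.tot
  obtain ⟨c, hc⟩ := hinter
  have hev : ∀ x : V, ∀ᶠ ε : ℝ in nhdsWithin 0 (Ioi 0), c + ε • (x - c) ∈ convexHull ℝ (Set.range b) := by
    intro x
    have hct : ContinuousAt (fun ε : ℝ => c + ε • (x - c)) 0 := by fun_prop
    have : interior (convexHull ℝ (Set.range b)) ∈ nhds ((fun ε : ℝ => c + ε • (x - c)) 0) := by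
      simp only [zero_smul, add_zero]
      exact isOpen_interior.mem_nhds hc
    have h2 := hct.preimage_mem_nhds this
    filter_upwards [nhdsWithin_le_nhds h2] with ε hε using interior_subset hε
  have hall : ∀ᶠ ε : ℝ in nhdsWithin 0 (Ioi 0), ∀ x ∈ {x | x ∈ F},
      c + ε • (x - c) ∈ convexHull ℝ (Set.range b) := by
    rw [Filter.eventually_all_finite (Multiset.finite_toSet F)]
    intro x _; exact hev x
  obtain ⟨ε, hε, hpos⟩ := (hall.and self_mem_nhdsWithin).exists
  have hpos : 0 < ε := hpos
  refine ⟨Finset.univ.val.map fun i => AffineMap.homothety c ε⁻¹ (b i), by simp, ?_⟩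
  intro x hx
  have h1 := hε x hx
  have hcx := (cv_convex (Finset.univ.val.map fun i => AffineMap.homothety c ε⁻¹ (b i))).affine_preimage
    (AffineMap.homothety c ε⁻¹)
  have h2 := convexHull_min (s := Set.range b) (by
    rintro _ ⟨i, rfl⟩
    exact mem_cv (Multiset.mem_map.2 ⟨i, by simp, rfl⟩)) hcx h1
  rw [mem_preimage, AffineMap.homothety_apply] at h2
  have : ε⁻¹ • (c + ε • (x - c) -ᵥ c) +ᵥ c = x := by
    simp [smul_smul, hpos.ne']
  rwa [this] at h2

end big


section step
variable {W : Type} [NormedAddCommGroup W] [NormedSpace ℝ W] [FiniteDimensional ℝ W]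
  [MeasurableSpace W] [BorelSpace W] (μ : Measure W) [μ.IsAddHaarMeasure]

/-- generic point -/
def Gen (H : List (W →ᵃ[ℝ] ℝ)) (x : W) : Prop := ∀ f ∈ H, f ≠ 0 → f x ≠ 0

lemma gen_ae (H : List (W →ᵃ[ℝ] ℝ)) : ∀ᵐ x ∂μ, Gen H x := by
  have : ∀ᵐ x ∂μ, ∀ f ∈ {f | f ∈ H}, f ≠ 0 → f x ≠ 0 := by
    rw [ae_ball_iff (List.finite_toSet H).countable]
    intro f _
    by_cases hf : f = 0
    · exact Filter.Eventually.of_forall fun x h => absurd hf h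
    · filter_upwards [null_hyper μ hf] with x hx using fun _ => hx
  exact this

lemma fine_sign {H : List (W →ᵃ[ℝ] ℝ)} {c : Multiset W} (hc : ∀ f ∈ H, Fine1 f c) {y : W}
    (hy : y ∈ cv c) (hg : Gen H y) {f : W →ᵃ[ℝ] ℝ} (hf : f ∈ H) (h0 : 0 ≤ f y) :
    ∀ x ∈ c, 0 ≤ f x := by
  by_cases hz : f = 0
  · subst hz; simp
  have hne := hg f hf hz
  rcases hc f hf with h | h
  · exact h
  · exact absurd (le_antisymm (cv_subset (affine_nonpos_convex f) h hy) h0) hne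

lemma cell_iff {H H' : List (W →ᵃ[ℝ] ℝ)} {c D : Multiset W} (hc : ∀ f ∈ H, Fine1 f c) {y : W}
    (hy : y ∈ cv c) (hg : Gen H y) (hH : ∀ f ∈ H', f ∈ H)
    (hD : cv D = {y | ∀ f ∈ H', 0 ≤ f y}) : (∀ x ∈ c, x ∈ cv D) ↔ y ∈ cv D := by
  constructor
  · intro h; exact cv_subset (cv_convex _) h hy
  · intro h x hx
    rw [hD] at h ⊢
    intro f hf
    exact fine_sign hc hy hg (hH f hf) (h f hf) x hx

lemma cell_sum {M : Type} [AddCommMonoid M] (hP : PStar μ) {K : Set W} {φ : Multiset W → M}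
    (hφ : IsFun (Module.finrank ℝ W + 1) K φ) {H H' : List (W →ᵃ[ℝ] ℝ)} {B D : Multiset W}
    {C : Multiset (Multiset W)} (hC : Diss (Module.finrank ℝ W + 1) B C)
    (hfine : ∀ c ∈ C, ∀ f ∈ H, Fine1 f c) (hDB : ∀ x ∈ D, x ∈ cv B)
    (hDc : D.card = Module.finrank ℝ W + 1) (hDK : ∀ x ∈ D, x ∈ K)
    (hH : ∀ f ∈ H', f ∈ H) (hD : cv D = {y | ∀ f ∈ H', 0 ≤ f y}) :
    φ D = ((C.filter fun c => ¬ Flat c).map fun c => if ∀ x ∈ c, x ∈ cv D then φ c else 0).sum := by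
  have hDK' := cv_subset hφ.conv hDK
  have h1 := hP M K φ hφ {D} ((C.filter fun c => ¬ Flat c).filter fun c => ∀ x ∈ c, x ∈ cv D)
    (by simpa using ⟨hDc, hDK⟩)
    (by
      intro c hc
      rw [Multiset.mem_filter, Multiset.mem_filter] at hc
      exact ⟨(hC.1 c hc.1.1).1, fun x hx => hDK' (hc.2 x hx)⟩)
    (by
      have hfl : ∀ᵐ x ∂μ, ∀ c ∈ {c | c ∈ C}, Flat c → iota (cv c) x = 0 := by
        rw [ae_ball_iff (Multiset.finite_toSet C).countable]
        intro t _
        by_cases hf : Flat t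
        · filter_upwards [iota_flat_ae μ hf] with p hp using fun _ => hp
        · exact Filter.Eventually.of_forall fun p h => absurd h hf
      filter_upwards [hfl, Diss.ae μ hC, gen_ae μ H] with x hx1 hx2 hx3
      simp only [Multiset.map_singleton, Multiset.sum_singleton]
      by_cases hxD : x ∈ cv D
      · have hxB : x ∈ cv B := cv_subset (cv_convex _) hDB hxD
        rw [← sum_filter_zero _ (fun c => ∀ x ∈ c, x ∈ cv D), ← sum_filter_zero, ← hx2]
        · simp [iota, hxD, hxB]
        · intro c hc hf
          push Not at hf
          exact hx1 c hc hf
        · intro c hc hn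
          have hcC := (Multiset.mem_filter.1 hc).1
          have : x ∉ cv c := fun hxc => hn ((cell_iff (hfine c hcC) hxc hx3 hH hD).2 hxD)
          simp [iota, this]
      · rw [Multiset.sum_eq_zero]
        · simp [iota, hxD]
        · intro z hz
          obtain ⟨c, hc, rfl⟩ := Multiset.mem_map.1 hz
          have hcD := (Multiset.mem_filter.1 hc).2
          have : x ∉ cv c := fun hxc => hxD (cv_subset (cv_convex _) hcD hxc)
          simp [iota, this])
  simp only [Multiset.map_singleton, Multiset.sum_singleton] at h1
  rw [h1, sum_filter_zero (C.filter fun c => ¬ Flat c) (fun c => ∀ x ∈ c, x ∈ cv D)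
    (fun c => if ∀ x ∈ c, x ∈ cv D then φ c else 0)]
  · congr 1
    apply Multiset.map_congr rfl
    intro c hc
    rw [if_pos (Multiset.mem_filter.1 hc).2]
  · intro c _ hn
    rw [if_neg hn]

/-- sheets of a family of prisms -/
def sheets (Λ : Multiset (Tri W)) : List (W →ᵃ[ℝ] ℝ) := Λ.toList.flatMap fun τ => [τ.g, τ.g']

lemma mem_sheets {Λ : Multiset (Tri W)} {h : W →ᵃ[ℝ] ℝ} :
    h ∈ sheets Λ ↔ ∃ τ ∈ Λ, h = τ.g ∨ h = τ.g' := by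
  simp [sheets]

lemma column {M : Type} [AddCommMonoid M] {K : Set (W × ℝ)} {φ : Multiset (W × ℝ) → M}
    (hφ : IsFun (Module.finrank ℝ W + 2) K φ) {H : List (W →ᵃ[ℝ] ℝ)} {c : Multiset W}
    (hcc : c.card = Module.finrank ℝ W + 1) (hc : ∀ f ∈ H, Fine1 f c) {y : W} (hy : y ∈ cv c)
    (hgen : Gen H y) (Λ Λ' : Multiset (Tri W))
    (hH : ∀ g ∈ sheets (Λ + Λ'), ∀ g' ∈ sheets (Λ + Λ'), g' - g ∈ H)
    (hΛ : ∀ τ ∈ Λ + Λ', ∀ x ∈ c, x ∈ PrK τ.g τ.g' K)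
    (hae : ∀ᵐ h : ℝ, (Λ.map fun τ => iota (Icc (τ.g y) (τ.g' y)) h).sum
      = (Λ'.map fun τ => iota (Icc (τ.g y) (τ.g' y)) h).sum) :
    (Λ.map fun τ => PrM τ.g τ.g' φ c).sum = (Λ'.map fun τ => PrM τ.g τ.g' φ c).sum := by
  have hinj : ∀ g ∈ sheets (Λ + Λ'), ∀ g' ∈ sheets (Λ + Λ'), g y = g' y → g = g' := by
    intro g hg g' hg' he
    by_contra hne
    have := hgen _ (hH g hg g' hg') (sub_ne_zero.2 (Ne.symm hne))
    apply this
    simp [he]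
  have hle : ∀ g ∈ sheets (Λ + Λ'), ∀ g' ∈ sheets (Λ + Λ'), g y ≤ g' y → ∀ x ∈ c, g x ≤ g' x := by
    intro g hg g' hg' h x hx
    have := fine_sign hc hy hgen (hH g hg g' hg') (by simpa using h) x hx
    simpa using this
  have hgr : ∀ g ∈ sheets (Λ + Λ'), ∀ x ∈ c, (x, g x) ∈ K := by
    intro g hg x hx
    obtain ⟨τ, hτ, rfl | rfl⟩ := mem_sheets.1 hg
    · exact (hΛ τ hτ x hx).1
    · exact (hΛ τ hτ x hx).2.1
  set A : Finset ℝ := ((sheets (Λ + Λ')).map fun g => g y).toFinset with hA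
  have hσ : ∀ a : ℝ, ∃ g : W →ᵃ[ℝ] ℝ, a ∈ A → g ∈ sheets (Λ + Λ') ∧ g y = a := by
    intro a
    by_cases ha : a ∈ A
    · rw [hA, List.mem_toFinset, List.mem_map] at ha
      obtain ⟨g, hg, rfl⟩ := ha
      exact ⟨g, fun _ => ⟨hg, rfl⟩⟩
    · exact ⟨0, fun h => absurd h ha⟩
  choose σ hσ using hσ
  have hmA : ∀ g ∈ sheets (Λ + Λ'), g y ∈ A := by
    intro g hg
    rw [hA, List.mem_toFinset, List.mem_map]
    exact ⟨g, hg, rfl⟩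
  have hσg : ∀ g ∈ sheets (Λ + Λ'), σ (g y) = g := by
    intro g hg
    have := hσ _ (hmA g hg)
    exact hinj _ this.1 _ hg this.2
  have hPrK : ∀ a ∈ A, ∀ b ∈ A, a ≤ b → ∀ x ∈ c, x ∈ PrK (σ a) (σ b) K := by
    intro a ha b hb hab x hx
    have h1 := hσ a ha
    have h2 := hσ b hb
    exact ⟨hgr _ h1.1 x hx, hgr _ h2.1 x hx, hle _ h1.1 _ h2.1 (by rw [h1.2, h2.2]; exact hab) x hx⟩
  have key := one_dim (fun a b => PrM (σ a) (σ b) φ c) A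
    (fun a ha => PrM_self hφ hcc (hPrK a ha a ha le_rfl))
    (fun a ha b hb d hd hab hbd => PrM_stack hφ hcc (hPrK a ha b hb hab) (hPrK b hb d hd hbd))
    (Λ.map fun τ => (τ.g y, τ.g' y)) (Λ'.map fun τ => (τ.g y, τ.g' y))
  have hs1 : ∀ τ ∈ Λ + Λ', τ.g ∈ sheets (Λ + Λ') := fun τ hτ => mem_sheets.2 ⟨τ, hτ, Or.inl rfl⟩
  have hs2 : ∀ τ ∈ Λ + Λ', τ.g' ∈ sheets (Λ + Λ') := fun τ hτ => mem_sheets.2 ⟨τ, hτ, Or.inr rfl⟩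
  have hPK : ∀ τ ∈ Λ + Λ', τ.g y ≤ τ.g' y := by
    intro τ hτ
    have := cv_subset (PrK_convex τ.g τ.g' hφ.conv) (hΛ τ hτ) hy
    exact this.2.2
  have hmem : ∀ τ ∈ Λ + Λ', τ.g y ∈ A ∧ τ.g' y ∈ A ∧ τ.g y ≤ τ.g' y := fun τ hτ =>
    ⟨hmA _ (hs1 τ hτ), hmA _ (hs2 τ hτ), hPK τ hτ⟩
  have key2 := key
    (by
      intro p hp
      obtain ⟨τ, hτ, rfl⟩ := Multiset.mem_map.1 hp
      exact hmem τ (Multiset.mem_add.2 (Or.inl hτ)))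
    (by
      intro p hp
      obtain ⟨τ, hτ, rfl⟩ := Multiset.mem_map.1 hp
      exact hmem τ (Multiset.mem_add.2 (Or.inr hτ)))
    (by simpa [Multiset.map_map] using hae)
  rw [Multiset.map_map, Multiset.map_map] at key2
  have conv : ∀ Λ₀ ≤ Λ + Λ', (Λ₀.map fun τ => PrM τ.g τ.g' φ c)
      = Λ₀.map ((fun p => PrM (σ p.1) (σ p.2) φ c) ∘ fun τ => (τ.g y, τ.g' y)) := by
    intro Λ₀ h0
    apply Multiset.map_congr rfl
    intro τ hτ
    have hτ' := Multiset.mem_of_le h0 hτ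
    simp only [Function.comp]
    rw [hσg _ (hs1 τ hτ'), hσg _ (hs2 τ hτ')]
  rw [conv Λ (Multiset.le_add_right _ _), conv Λ' (Multiset.le_add_left _ _)]
  exact key2

lemma prism_core (hP : PStar μ) {M : Type} [AddCommMonoid M] {K : Set (W × ℝ)}
    {φ : Multiset (W × ℝ) → M} (hφ : IsFun (Module.finrank ℝ W + 2) K φ) (Λ Λ' : Multiset (Tri W))
    (hΛ : ∀ τ ∈ Λ + Λ', τ.Good K)
    (hae : ∀ᵐ p ∂(μ.prod (volume : Measure ℝ)), (Λ.map fun τ => iota τ.R p).sum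
      = (Λ'.map fun τ => iota τ.R p).sum) :
    (Λ.map fun τ => PrM τ.g τ.g' φ τ.D).sum = (Λ'.map fun τ => PrM τ.g τ.g' φ τ.D).sum := by
  have hHt : ∀ τ : Tri W, ∃ H : List (W →ᵃ[ℝ] ℝ), τ ∈ Λ + Λ' → cv τ.D = {y | ∀ f ∈ H, 0 ≤ f y} := by
    intro τ
    by_cases hτ : τ ∈ Λ + Λ'
    · obtain ⟨H, _, h⟩ := cv_eq_halfspaces (hΛ τ hτ).1 (hΛ τ hτ).2.1
      exact ⟨H, fun _ => h⟩
    · exact ⟨[], fun h => absurd h hτ⟩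
  choose Ht hHt using hHt
  set H : List (W →ᵃ[ℝ] ℝ) := (Λ + Λ').toList.flatMap Ht ++
    (sheets (Λ + Λ')).flatMap (fun g => (sheets (Λ + Λ')).map fun g' => g' - g) with hHdef
  have hH1 : ∀ τ ∈ Λ + Λ', ∀ f ∈ Ht τ, f ∈ H := by
    intro τ hτ f hf
    rw [hHdef, List.mem_append]
    left
    exact List.mem_flatMap.2 ⟨τ, Multiset.mem_toList.2 hτ, hf⟩
  have hH2 : ∀ g ∈ sheets (Λ + Λ'), ∀ g' ∈ sheets (Λ + Λ'), g' - g ∈ H := by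
    intro g hg g' hg'
    rw [hHdef, List.mem_append]
    right
    exact List.mem_flatMap.2 ⟨g, hg, List.mem_map.2 ⟨g', hg', rfl⟩⟩
  obtain ⟨B, hB, hBsub⟩ := big_simplex ((Λ + Λ').bind fun τ => τ.D)
  obtain ⟨C, hC, hfine⟩ := fine _ H B hB
  have expand : ∀ Λ₀ ≤ Λ + Λ', (Λ₀.map fun τ => PrM τ.g τ.g' φ τ.D).sum
      = ((C.filter fun c => ¬ Flat c).map fun c =>
          ((Λ₀.filter fun τ => ∀ x ∈ c, x ∈ cv τ.D).map fun τ => PrM τ.g τ.g' φ c).sum).sum := by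
    intro Λ₀ h0
    have : (Λ₀.map fun τ => PrM τ.g τ.g' φ τ.D) = Λ₀.map fun τ =>
        ((C.filter fun c => ¬ Flat c).map fun c =>
          if ∀ x ∈ c, x ∈ cv τ.D then PrM τ.g τ.g' φ c else 0).sum := by
      apply Multiset.map_congr rfl
      intro τ hτ
      have hτ' := Multiset.mem_of_le h0 hτ
      exact cell_sum μ hP (PrM_isFun (g := τ.g) (g' := τ.g') hφ) hC hfine
        (fun x hx => hBsub x (Multiset.mem_bind.2 ⟨τ, hτ', hx⟩)) (hΛ τ hτ').1 (hΛ τ hτ').2.2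
        (hH1 τ hτ') (hHt τ hτ')
    rw [this, Multiset.sum_map_sum_map]
    congr 1
    apply Multiset.map_congr rfl
    intro c _
    rw [sum_filter_zero Λ₀ (fun τ => ∀ x ∈ c, x ∈ cv τ.D)]
    · congr 1
      apply Multiset.map_congr rfl
      intro τ hτ
      rw [if_pos (Multiset.mem_filter.1 hτ).2]
    · intro τ _ hn
      rw [if_neg hn]
  rw [expand Λ (Multiset.le_add_right _ _), expand Λ' (Multiset.le_add_left _ _)]
  congr 1
  apply Multiset.map_congr rfl
  intro c hc
  rw [Multiset.mem_filter] at hc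
  have hy : ∃ y ∈ cv c, Gen H y ∧ ∀ᵐ h : ℝ, (Λ.map fun τ => iota τ.R (y, h)).sum
      = (Λ'.map fun τ => iota τ.R (y, h)).sum := by
    by_contra hcon
    apply nonflat_pos μ hc.2
    rw [measure_eq_zero_iff_ae_notMem]
    filter_upwards [gen_ae μ H, Measure.ae_ae_of_ae_prod hae] with y h1 h2 h3
    exact hcon ⟨y, h3, h1, h2⟩
  obtain ⟨y, hyc, hgen, hyae⟩ := hy
  have hcell : ∀ τ ∈ Λ + Λ', ((∀ x ∈ c, x ∈ cv τ.D) ↔ y ∈ cv τ.D) := fun τ hτ =>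
    cell_iff (hfine c hc.1) hyc hgen (hH1 τ hτ) (hHt τ hτ)
  have conv : ∀ Λ₀ ≤ Λ + Λ', ∀ h : ℝ, (Λ₀.map fun τ => iota τ.R (y, h)).sum =
      ((Λ₀.filter fun τ => ∀ x ∈ c, x ∈ cv τ.D).map fun τ => iota (Icc (τ.g y) (τ.g' y)) h).sum := by
    intro Λ₀ h0 h
    rw [sum_filter_zero Λ₀ (fun τ => ∀ x ∈ c, x ∈ cv τ.D)]
    · congr 1
      apply Multiset.map_congr rfl
      intro τ hτ
      rw [Multiset.mem_filter] at hτ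
      have := (hcell τ (Multiset.mem_of_le h0 hτ.1)).1 hτ.2
      simp [iota, Tri.R, this]
    · intro τ hτ hn
      rw [hcell τ (Multiset.mem_of_le h0 hτ)] at hn
      simp [iota, Tri.R, hn]
  have hsub : ∀ τ ∈ (Λ.filter fun τ => ∀ x ∈ c, x ∈ cv τ.D) + (Λ'.filter fun τ => ∀ x ∈ c, x ∈ cv τ.D),
      τ ∈ Λ + Λ' ∧ ∀ x ∈ c, x ∈ cv τ.D := by
    intro τ hτ
    rw [← Multiset.filter_add, Multiset.mem_filter] at hτ
    exact hτ
  have hsh : ∀ g ∈ sheets ((Λ.filter fun τ => ∀ x ∈ c, x ∈ cv τ.D) +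
      (Λ'.filter fun τ => ∀ x ∈ c, x ∈ cv τ.D)), g ∈ sheets (Λ + Λ') := by
    intro g hg
    obtain ⟨τ, hτ, h⟩ := mem_sheets.1 hg
    exact mem_sheets.2 ⟨τ, (hsub τ hτ).1, h⟩
  apply column hφ (hC.1 c hc.1).1 (hfine c hc.1) hyc hgen
  · intro g hg g' hg'
    exact hH2 g (hsh g hg) g' (hsh g' hg')
  · intro τ hτ x hx
    obtain ⟨h1, h2⟩ := hsub τ hτ
    exact cv_subset (PrK_convex τ.g τ.g' hφ.conv) (hΛ τ h1).2.2 (h2 x hx)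
  · filter_upwards [hyae] with h hh
    rw [← conv Λ (Multiset.le_add_right _ _), ← conv Λ' (Multiset.le_add_left _ _)]
    exact hh

lemma pstar_step (hP : PStar μ) : PStar (μ.prod (volume : Measure ℝ)) := by
  intro M _ K φ hφ L L' hL hL' hae
  have hfr : Module.finrank ℝ (W × ℝ) + 1 = Module.finrank ℝ W + 2 := by simp
  rw [hfr] at hφ hL hL'
  have : ∀ s : Multiset (W × ℝ), ∃ Λ : Multiset (Tri W), s.card = Module.finrank ℝ W + 2 →
      (∀ τ ∈ Λ, τ.Good (cv s)) ∧
      (∀ (M : Type) [AddCommMonoid M] (K : Set (W × ℝ)) (φ : Multiset (W × ℝ) → M),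
        IsFun (Module.finrank ℝ W + 2) K φ → (∀ x ∈ s, x ∈ K) →
        φ s = (Λ.map fun τ => PrM τ.g τ.g' φ τ.D).sum) ∧
      ∀ᵐ p ∂(μ.prod (volume : Measure ℝ)), iota (cv s) p = (Λ.map fun τ => iota τ.R p).sum := by
    intro s
    by_cases hs : s.card = Module.finrank ℝ W + 2
    · obtain ⟨Λ, h⟩ := triples (μ.prod (volume : Measure ℝ)) s hs
      exact ⟨Λ, fun _ => h⟩
    · exact ⟨0, fun h => absurd h hs⟩
  choose T hT using this
  have hgood : ∀ L : Multiset (Multiset (W × ℝ)),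
      (∀ s ∈ L, s.card = Module.finrank ℝ W + 2 ∧ ∀ x ∈ s, x ∈ K) →
      ∀ τ ∈ L.bind T, τ.Good K := by
    intro L hL τ hτ
    obtain ⟨s, hs, hτ⟩ := Multiset.mem_bind.1 hτ
    obtain ⟨h1, h2, h3⟩ := (hT s (hL s hs).1).1 τ hτ
    have hsub := cv_subset hφ.conv (hL s hs).2
    exact ⟨h1, h2, fun y hy => ⟨hsub (h3 y hy).1, hsub (h3 y hy).2.1, (h3 y hy).2.2⟩⟩
  have hsum : ∀ L : Multiset (Multiset (W × ℝ)),
      (∀ s ∈ L, s.card = Module.finrank ℝ W + 2 ∧ ∀ x ∈ s, x ∈ K) →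
      (L.map φ).sum = ((L.bind T).map fun τ => PrM τ.g τ.g' φ τ.D).sum := by
    intro L hL
    rw [Multiset.map_bind, Multiset.sum_bind]
    congr 1
    apply Multiset.map_congr rfl
    intro s hs
    exact (hT s (hL s hs).1).2.1 M K φ hφ (hL s hs).2
  have hind : ∀ L : Multiset (Multiset (W × ℝ)),
      (∀ s ∈ L, s.card = Module.finrank ℝ W + 2 ∧ ∀ x ∈ s, x ∈ K) →
      ∀ᵐ p ∂(μ.prod (volume : Measure ℝ)), (L.map fun s => iota (cv s) p).sum =
        ((L.bind T).map fun τ => iota τ.R p).sum := by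
    intro L hL
    have : ∀ᵐ p ∂(μ.prod (volume : Measure ℝ)), ∀ s ∈ {s | s ∈ L},
        iota (cv s) p = ((T s).map fun τ => iota τ.R p).sum := by
      rw [ae_ball_iff (Multiset.finite_toSet L).countable]
      intro s hs
      exact (hT s (hL s hs).1).2.2
    filter_upwards [this] with p hp
    rw [Multiset.map_bind, Multiset.sum_bind]
    congr 1
    exact Multiset.map_congr rfl hp
  rw [hsum L hL, hsum L' hL']
  apply prism_core μ hP hφ
  · intro τ hτ
    rcases Multiset.mem_add.1 hτ with h | h
    · exact hgood L hL τ h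
    · exact hgood L' hL' τ h
  · filter_upwards [hae, hind L hL, hind L' hL'] with p h1 h2 h3
    rw [← h2, ← h3, h1]

end step

/-- Bundled statement: a model of dimension `n` where the main property holds. -/
lemma pstar_exists (n : ℕ) : ∃ (V : Type) (_ : NormedAddCommGroup V) (_ : NormedSpace ℝ V)
    (_ : FiniteDimensional ℝ V) (_ : MeasurableSpace V) (_ : BorelSpace V) (μ : Measure V)
    (_ : μ.IsAddHaarMeasure), Module.finrank ℝ V = n ∧ PStar μ := by
  induction n with
  | zero =>
    refine ⟨Fin 0 → ℝ, inferInstance, inferInstance, inferInstance, inferInstance, inferInstance,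
      volume, inferInstance, by simp, ?_⟩
    intro M _ K φ hφ L L' hL hL' hae
    have hall : ∀ s : Multiset (Fin 0 → ℝ), s.card = Module.finrank ℝ (Fin 0 → ℝ) + 1 → s = {0} := by
      intro s hs
      simp only [Module.finrank_fin_fun, zero_add] at hs
      obtain ⟨x, rfl⟩ := Multiset.card_eq_one.1 hs
      rw [Subsingleton.elim x 0]
    have e1 : ∀ L : Multiset (Multiset (Fin 0 → ℝ)),
        (∀ s ∈ L, s.card = Module.finrank ℝ (Fin 0 → ℝ) + 1 ∧ ∀ x ∈ s, x ∈ K) →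
        L = Multiset.replicate L.card {0} := by
      intro L hL
      exact Multiset.eq_replicate_card.2 fun s hs => hall s (hL s hs).1
    have hne : ∃ x : Fin 0 → ℝ, (L.map fun s => iota (cv s) x).sum = (L'.map fun s => iota (cv s) x).sum :=
      hae.exists
    obtain ⟨x, hx⟩ := hne
    have hc : L.card = L'.card := by
      rw [e1 L hL, e1 L' hL'] at hx
      have hm : x ∈ cv ({0} : Multiset (Fin 0 → ℝ)) := by
        rw [Subsingleton.elim x 0]; exact mem_cv (by simp)
      have hi : iota (cv ({0} : Multiset (Fin 0 → ℝ))) x = 1 := by rw [iota, if_pos hm]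
      simp only [Multiset.map_replicate, hi, Multiset.sum_replicate, smul_eq_mul, mul_one] at hx
      exact hx
    rw [e1 L hL, e1 L' hL', hc]
  | succ n ih =>
    obtain ⟨V, _, _, _, _, _, μ, _, hn, hP⟩ := ih
    exact ⟨V × ℝ, inferInstance, inferInstance, inferInstance, inferInstance, inferInstance,
      μ.prod volume, inferInstance, by simp [hn], pstar_step μ hP⟩


section geom
lemma set_map_univ {ι α : Type} [Fintype ι] (w : ι → α) :
    {x | x ∈ Finset.univ.val.map w} = range w := by ext x; simp

variable {V : Type} [NormedAddCommGroup V] [NormedSpace ℝ V] [FiniteDimensional ℝ V]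

lemma half_cv {f : V →ᵃ[ℝ] ℝ} {b x : V} {t : Multiset V} (ht : t ≠ 0) (h0 : ∀ y ∈ t, f y = 0)
    (hb : 0 < f b) (hx : x ∈ cv (b ::ₘ t)) (hfx : f x ≤ 0) : x ∈ cv t := by
  have e : {y | y ∈ b ::ₘ t} = insert b {y | y ∈ t} := by ext y; simp
  have hne : {y | y ∈ t}.Nonempty := by
    obtain ⟨y, hy⟩ := Multiset.exists_mem_of_ne_zero ht
    exact ⟨y, hy⟩
  rw [cv, e, convexHull_insert hne] at hx
  simp only [convexJoin_singleton_left, mem_iUnion] at hx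
  obtain ⟨y, hy, α, β, hα, hβ, hαβ, rfl⟩ := hx
  have hy0 : f y = 0 := Flat.cv h0 y hy
  rw [affine_combo f hαβ, hy0] at hfx
  have hα0 : α = 0 := by
    by_contra hne'
    have : 0 < α := lt_of_le_of_ne hα (Ne.symm hne')
    nlinarith [mul_pos this hb]
  have hβ1 : β = 1 := by linarith
  subst hα0 hβ1
  rw [zero_smul, one_smul, zero_add]
  exact hy

/-- A hyperplane through `m` and `s` separating `a` from `b`. -/
lemma sep_hyper {a b m : V} {s : Multiset V} (hs : s.card + 2 = Module.finrank ℝ V + 1)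
    (hf : ¬ Flat (a ::ₘ b ::ₘ s)) (hm : m ∈ openSegment ℝ a b) :
    ∃ f : V →ᵃ[ℝ] ℝ, (∀ y ∈ m ::ₘ s, f y = 0) ∧ f a < 0 ∧ 0 < f b := by
  obtain ⟨f, hf0, hz⟩ : Flat (m ::ₘ s) := flat_of_card (by simp; omega)
  obtain ⟨α, β, hα, hβ, hαβ, rfl⟩ := hm
  have hmz := hz _ (Multiset.mem_cons_self _ _)
  rw [affine_combo f hαβ] at hmz
  have hane : f a ≠ 0 := by
    intro h
    apply hf
    refine ⟨f, hf0, ?_⟩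
    have hb : f b = 0 := by
      rw [h] at hmz; simp at hmz; rcases hmz with h | h
      · linarith
      · exact h
    intro x hx
    simp only [Multiset.mem_cons] at hx
    rcases hx with rfl | rfl | hx
    · exact h
    · exact hb
    · exact hz x (by simp [hx])
  rcases lt_or_gt_of_ne hane with h | h
  · refine ⟨f, hz, h, ?_⟩
    by_contra hc
    nlinarith [mul_neg_of_pos_of_neg hα h]
  · refine ⟨-f, fun y hy => by simp [hz y hy], by simpa using h, ?_⟩
    have : f b < 0 := by
      by_contra hc
      nlinarith [mul_pos hα h]
    simpa using this

lemma cut_halves {a b m : V} {s : Multiset V} (hm : m ∈ openSegment ℝ a b) {f : V →ᵃ[ℝ] ℝ}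
    (h0 : ∀ y ∈ m ::ₘ s, f y = 0) (ha : f a < 0) (hb : 0 < f b) :
    cv (a ::ₘ m ::ₘ s) = cv (a ::ₘ b ::ₘ s) ∩ {x | f x ≤ 0} ∧
    cv (m ::ₘ b ::ₘ s) = cv (a ::ₘ b ::ₘ s) ∩ {x | 0 ≤ f x} := by
  have hc := cv_cut s (openSegment_subset_segment ℝ a b hm)
  constructor
  · ext x
    constructor
    · intro hx
      refine ⟨by rw [hc]; exact Or.inl hx, ?_⟩
      refine cv_subset (affine_nonpos_convex f) ?_ hx
      intro y hy
      rw [Multiset.mem_cons] at hy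
      rcases hy with rfl | hy
      · exact ha.le
      · exact (h0 y hy).le
    · rintro ⟨hx, hfx⟩
      rw [hc] at hx
      rcases hx with hx | hx
      · exact hx
      · rw [Multiset.cons_swap] at hx
        have := half_cv (by simp) h0 hb hx hfx
        exact cv_subset (cv_convex _) (fun y hy => mem_cv (Multiset.mem_cons_of_mem hy)) this
  · ext x
    constructor
    · intro hx
      refine ⟨by rw [hc]; exact Or.inr hx, ?_⟩
      refine cv_subset (affine_nonneg_convex f) ?_ hx
      intro y hy
      rw [Multiset.cons_swap, Multiset.mem_cons] at hy
      rcases hy with rfl | hy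
      · exact hb.le
      · exact (h0 y hy).ge
    · rintro ⟨hx, hfx⟩
      rw [hc] at hx
      rcases hx with hx | hx
      · have := half_cv (f := -f) (by simp) (fun y hy => by simp [h0 y hy]) (by simpa using ha) hx
          (by simpa using hfx)
        rw [Multiset.cons_swap]
        exact cv_subset (cv_convex _) (fun y hy => mem_cv (Multiset.mem_cons_of_mem hy)) this
      · exact hx

/-- Both parts of a proper cut are nondegenerate. -/
lemma cut_nonflat {a b m : V} {s : Multiset V} (hm : m ∈ openSegment ℝ a b)
    (hf : ¬ Flat (a ::ₘ b ::ₘ s)) : ¬ Flat (a ::ₘ m ::ₘ s) ∧ ¬ Flat (m ::ₘ b ::ₘ s) := by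
  obtain ⟨α, β, hα, hβ, hαβ, rfl⟩ := hm
  constructor
  · rintro ⟨f, hf0, hz⟩
    apply hf
    refine ⟨f, hf0, ?_⟩
    have h1 := hz a (by simp)
    have h2 := hz (α • a + β • b) (by simp)
    rw [affine_combo f hαβ, h1] at h2
    have hb : f b = 0 := by
      simp at h2; rcases h2 with h | h
      · linarith
      · exact h
    intro x hx
    simp only [Multiset.mem_cons] at hx
    rcases hx with rfl | rfl | hx
    · exact h1
    · exact hb
    · exact hz x (by simp [hx])
  · rintro ⟨f, hf0, hz⟩
    apply hf
    refine ⟨f, hf0, ?_⟩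
    have h1 := hz b (by simp)
    have h2 := hz (α • a + β • b) (by simp)
    rw [affine_combo f hαβ, h1] at h2
    have hb : f a = 0 := by
      simp at h2; rcases h2 with h | h
      · linarith
      · exact h
    intro x hx
    simp only [Multiset.mem_cons] at hx
    rcases hx with rfl | rfl | hx
    · exact hb
    · exact h1
    · exact hz x (by simp [hx])

variable {N : ℕ} (A : V →ᵃ[ℝ] Euc N)

lemma simplex_image (hA : Function.Injective A) {s : Multiset V} (hs : s.card = Module.finrank ℝ V + 1) (hf : ¬ Flat s) :
    ∃ v : Fin (Module.finrank ℝ V + 1) → V, Finset.univ.val.map v = s ∧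
      AffineIndependent ℝ (fun i => A (v i)) ∧
      A '' cv s = convexHull ℝ (range fun i => A (v i)) := by
  obtain ⟨v, hv⟩ := exists_fin_map s hs
  obtain ⟨b, hb⟩ := nonflat_basis' v hv hf
  refine ⟨v, hv, ?_, ?_⟩
  · have := b.ind.map' A hA
    rw [hb] at this
    exact this
  · rw [cv, AffineMap.image_convexHull]
    congr 1
    rw [← hv, set_map_univ, ← range_comp]; rfl

lemma isSimplex_image (hA : Function.Injective A) {s : Multiset V} (hs : s.card = Module.finrank ℝ V + 1) (hf : ¬ Flat s) :
    IsSimplex (Module.finrank ℝ V) (A '' cv s) := by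
  obtain ⟨v, _, h1, h2⟩ := simplex_image A hA hs hf
  exact ⟨_, h1, h2⟩

lemma simplex_pull (_hA : Function.Injective A) {S : Set (Euc N)} (hS : IsSimplex (Module.finrank ℝ V) S) (hr : S ⊆ range A) :
    ∃ s : Multiset V, s.card = Module.finrank ℝ V + 1 ∧ ¬ Flat s ∧ A '' cv s = S := by
  obtain ⟨v, hv, rfl⟩ := hS
  have : ∀ i, ∃ x, A x = v i := fun i => hr (subset_convexHull ℝ _ (mem_range_self i))
  choose w hw using this
  have hv' : v = A ∘ w := by ext1 i; simp [hw]
  have hw' : AffineIndependent ℝ w := by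
    rw [hv'] at hv
    exact AffineIndependent.of_comp A hv
  have htop : affineSpan ℝ (range w) = ⊤ :=
    hw'.affineSpan_eq_top_iff_card_eq_finrank_add_one.2 (by simp)
  let b : AffineBasis (Fin (Module.finrank ℝ V + 1)) ℝ V := ⟨w, hw', htop⟩
  refine ⟨Finset.univ.val.map w, by simp, basis_not_flat b, ?_⟩
  rw [cv, AffineMap.image_convexHull]
  congr 1
  rw [hv', range_comp, set_map_univ]

lemma isDissection_cut (hA : Function.Injective A) {a b m : V} {s : Multiset V} (hs : s.card + 2 = Module.finrank ℝ V + 1)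
    (hf : ¬ Flat (a ::ₘ b ::ₘ s)) (hm : m ∈ openSegment ℝ a b) :
    IsDissection (Module.finrank ℝ V) (A '' cv (a ::ₘ b ::ₘ s)) (A '' cv (a ::ₘ m ::ₘ s))
      (A '' cv (m ::ₘ b ::ₘ s)) := by
  obtain ⟨f0, h0, ha, hb⟩ := sep_hyper hs hf hm
  obtain ⟨hc1, hc2⟩ := cut_halves hm h0 ha hb
  obtain ⟨hn1, hn2⟩ := cut_nonflat hm hf
  have hAl : Function.Injective A.linear := (AffineMap.linear_injective_iff A).2 hA
  obtain ⟨g, hg⟩ := LinearMap.exists_leftInverse_of_injective A.linear (LinearMap.ker_eq_bot.2 hAl)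
  set f : Euc N →ₗ[ℝ] ℝ := f0.linear ∘ₗ g with hfdef
  have hfA : ∀ x, f (A x) = f0 x + (f (A 0) - f0 0) := by
    intro x
    have e1 : A x = A.linear x + A 0 := by
      have := A.map_vadd 0 x; simpa using this
    have e2 : f0 x = f0.linear x + f0 0 := by
      have := f0.map_vadd 0 x; simpa using this
    have e3 : g (A.linear x) = x := by
      have := LinearMap.congr_fun hg x; simpa using this
    have : f (A.linear x) = f0.linear x := by simp [hfdef, e3]
    rw [e1, map_add, this, e2]; ring
  set c : ℝ := f (A 0) - f0 0 with hcdef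
  refine ⟨isSimplex_image A hA (by simp; omega) hn1, isSimplex_image A hA (by simp; omega) hn2, ?_, ?_, f, c, ?_, ?_, ?_, ?_⟩
  · rw [← image_union, ← cv_cut s (openSegment_subset_segment ℝ a b hm)]
  · intro h
    have h' := hA.image_injective h
    have : a ∈ cv (m ::ₘ b ::ₘ s) := by rw [← h']; exact mem_cv (by simp)
    rw [hc2] at this
    exact absurd this.2 (not_le.2 ha)
  · intro h
    have h1 := hfA a
    have h2 := hfA b
    simp only [h, LinearMap.zero_apply] at h1 h2
    linarith
  · rw [hc1]
    ext y
    constructor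
    · rintro ⟨x, ⟨hx, hx'⟩, rfl⟩
      exact ⟨⟨x, hx, rfl⟩, by simp only [mem_ofPred_eq] at hx' ⊢; rw [hfA]; linarith⟩
    · rintro ⟨⟨x, hx, rfl⟩, hx'⟩
      exact ⟨x, ⟨hx, by simp only [mem_ofPred_eq] at hx' ⊢; rw [hfA] at hx'; linarith⟩, rfl⟩
  · rw [hc2]
    ext y
    constructor
    · rintro ⟨x, ⟨hx, hx'⟩, rfl⟩
      exact ⟨⟨x, hx, rfl⟩, by simp only [mem_ofPred_eq] at hx' ⊢; rw [hfA]; linarith⟩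
    · rintro ⟨⟨x, hx, rfl⟩, hx'⟩
      exact ⟨x, ⟨hx, by simp only [mem_ofPred_eq] at hx' ⊢; rw [hfA] at hx'; linarith⟩, rfl⟩
  · obtain ⟨v, hv, h1, h2⟩ := simplex_image A hA (s := a ::ₘ b ::ₘ s) (by simp; omega) hf
    refine ⟨_, h1, h2, ?_⟩
    have hcount : s.card ≤ (Finset.univ.filter fun i => f0 (v i) = 0).card := by
      have e : Multiset.countP (fun x => f0 x = 0) (Finset.univ.val.map v)
          = (Finset.univ.filter fun i => f0 (v i) = 0).card := by
        rw [Multiset.countP_map]; rfl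
      rw [← e, hv, Multiset.countP_cons, Multiset.countP_cons]
      have : Multiset.countP (fun x => f0 x = 0) s = s.card :=
        Multiset.countP_eq_card.2 fun x hx => h0 x (by simp [hx])
      omega
    obtain ⟨t, ht, htc⟩ := Finset.exists_subset_card_eq hcount
    refine ⟨t, by omega, ?_⟩
    intro i hi
    have := (Finset.mem_filter.1 (ht hi)).2
    simp only [hfA, this, zero_add]

lemma iota_image (hA : Function.Injective A) (X : Set V) (x : V) : iota (A '' X) (A x) = iota X x := by
  simp only [iota, hA.mem_set_image]

lemma preimage_image' (hA : Function.Injective A) (X : Set V) : A ⁻¹' (A '' X) = X := hA.preimage_image X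

end geom


section moves
variable {V : Type} [NormedAddCommGroup V] [NormedSpace ℝ V] [FiniteDimensional ℝ V]
  [MeasurableSpace V] [BorelSpace V] (μ : Measure V) [μ.IsAddHaarMeasure]
  {N : ℕ} (A : V →ᵃ[ℝ] Euc N)

/-- Generating relation: a simplex is related to the two parts of a proper cut. -/
def GenRel (X Y : Multiset (Set (Euc N))) : Prop :=
  ∃ a b m : V, ∃ s : Multiset V, s.card + 2 = Module.finrank ℝ V + 1 ∧ ¬ Flat (a ::ₘ b ::ₘ s) ∧
    m ∈ openSegment ℝ a b ∧ X = {A '' cv (a ::ₘ b ::ₘ s)} ∧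
    Y = {A '' cv (a ::ₘ m ::ₘ s)} + {A '' cv (m ::ₘ b ::ₘ s)}

/-- The universal functional. -/
def uphi (s : Multiset V) : (addConGen (GenRel A)).Quotient :=
  if Flat s then 0 else (({A '' cv s} : Multiset (Set (Euc N))) : (addConGen (GenRel A)).Quotient)

lemma uphi_isFun : IsFun (Module.finrank ℝ V + 1) (univ : Set V) (uphi A) where
  conv := convex_univ
  rep := by
    intro a s _ _ hc
    rw [uphi, if_pos (flat_rep (by omega))]
  flat := by
    intro s hc hK hF
    rw [uphi, if_pos hF]
  cut := by
    intro a b m s _ _ _ hc hm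
    have hrep : ∀ a : V, uphi A (a ::ₘ a ::ₘ s) = 0 := by
      intro a; rw [uphi, if_pos (flat_rep (by omega))]
    by_cases hF : Flat (a ::ₘ b ::ₘ s)
    · have hmc : m ∈ cv (a ::ₘ b ::ₘ s) :=
        (cv_convex _).segment_subset (mem_cv (by simp)) (mem_cv (by simp)) hm
      have h1 : Flat (a ::ₘ m ::ₘ s) := hF.mono (by
        intro x hx
        simp only [Multiset.mem_cons] at hx
        rcases hx with rfl | rfl | hx
        · exact mem_cv (by simp)
        · exact hmc
        · exact mem_cv (by simp [hx]))
      have h2 : Flat (m ::ₘ b ::ₘ s) := hF.mono (by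
        intro x hx
        simp only [Multiset.mem_cons] at hx
        rcases hx with rfl | rfl | hx
        · exact hmc
        · exact mem_cv (by simp)
        · exact mem_cv (by simp [hx]))
      rw [uphi, uphi, uphi, if_pos hF, if_pos h1, if_pos h2, add_zero]
    · by_cases hma : m = a
      · subst hma; rw [hrep, zero_add]
      by_cases hmb : m = b
      · subst hmb; rw [hrep, add_zero]
      have hmo : m ∈ openSegment ℝ a b :=
        mem_openSegment_of_ne_left_right (Ne.symm hma) (Ne.symm hmb) hm
      obtain ⟨h1, h2⟩ := cut_nonflat hmo hF
      rw [uphi, uphi, uphi, if_neg hF, if_neg h1, if_neg h2, ← AddCon.coe_add]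
      apply (AddCon.eq _).2
      exact AddConGen.Rel.of _ _ ⟨a, b, m, s, hc, hF, hmo, rfl, rfl⟩

/-- Families which are essentially disjoint with members of positive measure. -/
def GoodFam (X : Multiset (Set (Euc N))) : Prop :=
  (∀ᵐ x ∂μ, (X.map fun S => iota S (A x)).sum ≤ 1) ∧ ∀ S ∈ X, μ (A ⁻¹' S) ≠ 0

lemma GoodFam.notMem {S : Set (Euc N)} {Z : Multiset (Set (Euc N))} (h : GoodFam μ A (S ::ₘ Z)) :
    S ∉ Z := by
  intro hS
  obtain ⟨Z', rfl⟩ := Multiset.exists_cons_of_mem hS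
  apply h.2 S (by simp)
  rw [← compl_compl (A ⁻¹' S)]
  change ∀ᵐ x ∂μ, x ∈ (A ⁻¹' S)ᶜ
  filter_upwards [h.1] with x hx hxS
  simp only [Multiset.map_cons, Multiset.sum_cons] at hx
  have : iota S (A x) = 1 := if_pos hxS
  omega


/-- Induction hypothesis on the congruence. -/
lemma moves_of_rel (hA : Function.Injective A) {X Y : Multiset (Set (Euc N))} (h : AddConGen.Rel (GenRel A) X Y) :
    ∀ Z, (GoodFam μ A (X + Z) ↔ GoodFam μ A (Y + Z)) ∧
      (GoodFam μ A (X + Z) →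
        MoveEquiv (Module.finrank ℝ V) (X + Z).toFinset (Y + Z).toFinset ∧
        MoveEquiv (Module.finrank ℝ V) (Y + Z).toFinset (X + Z).toFinset) := by
  induction h with
  | of X Y h =>
    intro Z
    obtain ⟨a, b, m, s, hs, hF, hm, rfl, rfl⟩ := h
    obtain ⟨hn1, hn2⟩ := cut_nonflat hm hF
    have hd := isDissection_cut A hA hs hF hm
    have hae := cut_ae μ hs (openSegment_subset_segment ℝ a b hm)
    have hp0 : μ (A ⁻¹' (A '' cv (a ::ₘ b ::ₘ s))) ≠ 0 := by
      rw [preimage_image' A hA]; exact nonflat_pos μ hF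
    have hp1 : μ (A ⁻¹' (A '' cv (a ::ₘ m ::ₘ s))) ≠ 0 := by
      rw [preimage_image' A hA]; exact nonflat_pos μ hn1
    have hp2 : μ (A ⁻¹' (A '' cv (m ::ₘ b ::ₘ s))) ≠ 0 := by
      rw [preimage_image' A hA]; exact nonflat_pos μ hn2
    have hae' : ∀ᵐ x ∂μ, iota (A '' cv (a ::ₘ b ::ₘ s)) (A x) =
        iota (A '' cv (a ::ₘ m ::ₘ s)) (A x) + iota (A '' cv (m ::ₘ b ::ₘ s)) (A x) := by
      filter_upwards [hae] with x hx
      simpa only [iota_image A hA] using hx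
    have hS := isSimplex_image A hA (s := a ::ₘ b ::ₘ s) (by simp; omega) hF
    generalize A '' cv (a ::ₘ b ::ₘ s) = S at *
    generalize A '' cv (a ::ₘ m ::ₘ s) = S1 at *
    generalize A '' cv (m ::ₘ b ::ₘ s) = S2 at *
    have hiff : GoodFam μ A ({S} + Z) ↔ GoodFam μ A ({S1} + {S2} + Z) := by
      unfold GoodFam
      refine and_congr ?_ ?_
      · apply Filter.eventually_congr
        filter_upwards [hae'] with x hx
        simp [hx, add_assoc]
      · simp only [Multiset.mem_add, Multiset.mem_singleton]
        constructor
        · rintro h T ((rfl | rfl) | hT)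
          · exact hp1
          · exact hp2
          · exact h T (Or.inr hT)
        · rintro h T (rfl | hT)
          · exact hp0
          · exact h T (Or.inr hT)
    refine ⟨hiff, fun hg => ?_⟩
    have hg' := hiff.1 hg
    have hSZ : S ∉ Z := GoodFam.notMem μ A (by simpa using hg)
    have hS1 : S1 ∉ S2 ::ₘ Z := GoodFam.notMem μ A (by simpa [add_assoc] using hg')
    have hS2 : S2 ∉ S1 ::ₘ Z := GoodFam.notMem μ A (by
      rw [add_comm ({S1} : Multiset (Set (Euc N))) {S2}] at hg'
      simpa [add_assoc] using hg')
    have e0 : ({S} + Z).toFinset = insert S Z.toFinset := by ext; simp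
    have e1 : ({S1} + {S2} + Z).toFinset = insert S1 (insert S2 Z.toFinset) := by ext; simp
    simp only [Multiset.mem_cons, not_or] at hS1 hS2
    rw [e0, e1]
    constructor
    · apply Relation.ReflTransGen.single
      refine Or.inl ⟨S, by simp, S1, S2, hd, ?_⟩
      rw [Finset.erase_insert (by simpa using hSZ)]
    · apply Relation.ReflTransGen.single
      refine Or.inr ⟨S1, by simp, S2, by simp, hS1.1, ?_, ?_⟩
      · rw [hd.2.2.1]; exact hS
      · rw [hd.2.2.1, Finset.erase_insert (by simpa using hS1), Finset.erase_insert (by simpa using hS2.2)]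
  | refl X => exact fun Z => ⟨Iff.rfl, fun _ => ⟨Relation.ReflTransGen.refl, Relation.ReflTransGen.refl⟩⟩
  | symm _ ih => exact fun Z => ⟨(ih Z).1.symm, fun h => ((ih Z).2 ((ih Z).1.2 h)).symm⟩
  | trans _ _ ih1 ih2 =>
    intro Z
    refine ⟨(ih1 Z).1.trans (ih2 Z).1, fun h => ?_⟩
    have h1 := (ih1 Z).2 h
    have h2 := (ih2 Z).2 ((ih1 Z).1.1 h)
    exact ⟨h1.1.trans h2.1, h2.2.trans h1.2⟩
  | @add W X Y Z _ _ ih1 ih2 =>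
    intro Q
    have i1 := ih1 (Y + Q)
    have i2 := ih2 (X + Q)
    have c1 : W + (Y + Q) = W + Y + Q := by abel
    have c2 : X + (Y + Q) = Y + (X + Q) := by abel
    have c3 : Z + (X + Q) = X + Z + Q := by abel
    rw [c1, c2] at i1
    rw [c3] at i2
    refine ⟨i1.1.trans i2.1, fun h => ?_⟩
    have h1 := i1.2 h
    have h2 := i2.2 (i1.1.1 h)
    exact ⟨h1.1.trans h2.1, h2.2.trans h1.2⟩

/-- Two distinct members of a triangulation overlap in a null set. -/
lemma null_of_sdim (hA : Function.Injective A) {Q : Set (Euc N)} (hQ : Q ⊆ range A) (hd : sdim Q < Module.finrank ℝ V) :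
    ∀ᵐ x ∂μ, A x ∉ Q := by
  have himg : A '' (A ⁻¹' Q) = Q := image_preimage_eq_of_subset hQ
  have hne : affineSpan ℝ (A ⁻¹' Q) ≠ ⊤ := by
    intro h
    have h1 : vectorSpan ℝ (A ⁻¹' Q) = ⊤ := by
      rw [← direction_affineSpan, h, AffineSubspace.direction_top]
    have h2 := AffineMap.map_vectorSpan A (s := A ⁻¹' Q)
    rw [himg, h1] at h2
    have hAl : Function.Injective A.linear := (AffineMap.linear_injective_iff A).2 hA
    rw [sdim, ← h2, Submodule.map_top, LinearMap.finrank_range_of_inj hAl] at hd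
    exact lt_irrefl _ hd
  have := Measure.addHaar_affineSubspace μ _ hne
  have h0 : μ (A ⁻¹' Q) = 0 := measure_mono_null (subset_affineSpan ℝ _) this
  exact measure_eq_zero_iff_ae_notMem.1 h0

lemma sum_iota_le {F : Finset (Set (Euc N))} {x : Euc N} (h : ∀ S ∈ F, ∀ T ∈ F, S ≠ T → x ∉ S ∩ T) :
    (F.val.map fun S => iota S x).sum = iota (⋃ S ∈ F, S) x := by
  change ∑ S ∈ F, iota S x = _
  by_cases hx : ∃ S ∈ F, x ∈ S
  · obtain ⟨S, hS, hxS⟩ := hx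
    rw [Finset.sum_eq_single S]
    · have hu : x ∈ ⋃ S ∈ F, S := by simp only [mem_iUnion]; exact ⟨S, hS, hxS⟩
      rw [iota, iota, if_pos hxS, if_pos hu]
    · intro T hT hTS
      exact if_neg fun hxT => h T hT S hS hTS ⟨hxT, hxS⟩
    · intro h; exact absurd hS h
  · push Not at hx
    have hz : ∀ S ∈ F, iota S x = 0 := fun S hS => if_neg (hx S hS)
    rw [Finset.sum_eq_zero hz, iota, if_neg]
    simpa using hx

lemma main_model (hA : Function.Injective A) (hP : PStar μ) {T : Set (Euc N)} (hT : IsSimplex (Module.finrank ℝ V) T)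
    (hTr : T ⊆ range A) {F : Finset (Set (Euc N))}
    (hF : IsTriangulation (Module.finrank ℝ V) T F) :
    MoveEquiv (Module.finrank ℝ V) F {T} := by
  obtain ⟨hF1, hF2, hF3⟩ := hF
  have hsub : ∀ S ∈ F, S ⊆ range A := fun S hS =>
    (subset_trans (by
      rw [← hF2]; intro y hy; simp only [mem_iUnion]; exact ⟨S, hS, hy⟩) hTr)
  obtain ⟨t0, htcard, htflat, ht0⟩ := simplex_pull A hA hT hTr
  have hpull : ∀ S, ∃ s : Multiset V, S ∈ F →
      s.card = Module.finrank ℝ V + 1 ∧ ¬ Flat s ∧ A '' cv s = S := by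
    intro S
    by_cases hS : S ∈ F
    · obtain ⟨s, hs⟩ := simplex_pull A hA (hF1 S hS) (hsub S hS)
      exact ⟨s, fun _ => hs⟩
    · exact ⟨0, fun h => absurd h hS⟩
  choose p hp using hpull
  have hdisj : ∀ᵐ x ∂μ, ∀ S ∈ F, ∀ S' ∈ F, S ≠ S' → A x ∉ S ∩ S' := by
    refine (Filter.eventually_all_finset F).2 fun S hS => ?_
    refine (Filter.eventually_all_finset F).2 fun S' hS' => ?_
    by_cases hne : S = S'
    · exact Filter.Eventually.of_forall fun x h => absurd hne h
    · filter_upwards [null_of_sdim μ A hA (inter_subset_left.trans (hsub S hS))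
        (hF3 S hS S' hS' hne)] with x hx _
      exact hx
  have hsum : ∀ᵐ x ∂μ, (F.val.map fun S => iota S (A x)).sum = iota T (A x) := by
    filter_upwards [hdisj] with x hx
    rw [sum_iota_le hx, hF2]
  have key := hP _ univ (uphi A) (uphi_isFun A) (F.val.map p) {t0} (by
      intro s hs
      obtain ⟨S, hS, rfl⟩ := Multiset.mem_map.1 hs
      exact ⟨(hp S hS).1, fun _ _ => mem_univ _⟩) (by
      intro s hs
      rw [Multiset.mem_singleton] at hs
      subst hs
      exact ⟨htcard, fun _ _ => mem_univ _⟩) (by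
      filter_upwards [hsum] with x hx
      rw [Multiset.map_map, Multiset.map_singleton, Multiset.sum_singleton,
        ← iota_image A hA (cv t0), ht0, ← hx]
      congr 1
      apply Multiset.map_congr rfl
      intro S hS
      simp only [Function.comp]
      rw [← iota_image A hA, (hp S hS).2.2])
  have hl : (Multiset.map (uphi A) (F.val.map p)).sum =
      ((F.val : Multiset (Set (Euc N))) : (addConGen (GenRel A)).Quotient) := by
    rw [Multiset.map_map]
    have e : Multiset.map (uphi A ∘ p) F.val =
        F.val.map fun S => (addConGen (GenRel A)).mk' {S} := by
      apply Multiset.map_congr rfl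
      intro S hS
      simp only [Function.comp]
      rw [uphi, if_neg (hp S hS).2.1, (hp S hS).2.2]
      rfl
    rw [e]
    have e2 := map_multiset_sum (addConGen (GenRel A)).mk' (F.val.map fun S => ({S} : Multiset (Set (Euc N))))
    rw [Multiset.map_map, Multiset.sum_map_singleton] at e2
    exact e2.symm
  rw [hl, Multiset.map_singleton, Multiset.sum_singleton, uphi, if_neg htflat, ht0] at key
  have hrel : AddConGen.Rel (GenRel A) F.val {T} := (AddCon.eq _).1 key
  have hm := moves_of_rel μ A hA hrel 0
  simp only [add_zero] at hm
  have hg : GoodFam μ A F.val := by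
    constructor
    · filter_upwards [hsum] with x hx
      rw [hx, iota]; split_ifs <;> omega
    · intro S hS
      rw [← (hp S hS).2.2, preimage_image' A hA]
      exact nonflat_pos μ (hp S hS).2.1
  have := (hm.2 hg).1
  simpa using this

end moves

/-- every triangulation of an `n`-simplex is equivalent by elementary moves
to the trivial triangulation. -/
theorem triangulation_of_simplex_equiv_trivial {N n : ℕ} (T : Set (Euc N))
    (hT : IsSimplex n T) (F : Finset (Set (Euc N))) (hF : IsTriangulation n T F) :
    MoveEquiv n F ({T} : Finset (Set (Euc N))) := by
  obtain ⟨V, _, _, _, _, _, μ, _, hn, hP⟩ := pstar_exists n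
  subst hn
  obtain ⟨v, hv, hTv⟩ := id hT
  have hfr : Module.finrank ℝ V = Module.finrank ℝ (vectorSpan ℝ (range v)) :=
    (hv.finrank_vectorSpan (by simp)).symm
  let e := LinearEquiv.ofFinrankEq V (vectorSpan ℝ (range v)) hfr
  let A : V →ᵃ[ℝ] Euc N :=
    ((vectorSpan ℝ (range v)).subtype ∘ₗ e.toLinearMap).toAffineMap + AffineMap.const ℝ V (v 0)
  have hAx : ∀ x, A x = (e x : Euc N) + v 0 := fun x => rfl
  have hA : Function.Injective A := by
    intro x y h
    rw [hAx, hAx] at h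
    exact e.injective (Subtype.ext (add_right_cancel h))
  have hr : T ⊆ range A := by
    rw [hTv]
    refine (convexHull_subset_affineSpan _).trans ?_
    intro y hy
    have h1 : y -ᵥ v 0 ∈ vectorSpan ℝ (range v) := by
      rw [← direction_affineSpan]
      exact AffineSubspace.vsub_mem_direction hy (subset_affineSpan ℝ _ (mem_range_self 0))
    refine ⟨e.symm ⟨_, h1⟩, ?_⟩
    rw [hAx]; simp
  exact main_model μ A hA hP hT hr hF
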